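/- arXiv:0807.1081 — 2 statements merged into one kernel-verified Lean document; each statement's English description precedes it below -/
import Mathlib

section
/- Let r_{2s}(n) denote the number of representations of a positive integer n as an ordered sum of 2s squares of integers, i.e. the cardinality of {x ∈ ℤ^{2s} : x₁² + ⋯ + x_{2s}² = n}. Then for all n ≥ 1: r₂(n) = 4·σ₀(n; 0,1,0,−1); r₄(n) = 8·σ₁(n; 0,1,1,1) = 8·σᶜ₁(n; −3,1,1,1); r₆(n) = 16·σᶜ₂(n; 0,1,0,−1) − 4·σ₂(n; 0,1,0,−1); and r₈(n) = 4·σ₃(n; 4,4,3,4) = 16·σᶜ₃(n; 15,1,−1,1). -/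
open Complex

noncomputable section

/-- The number of representations of n as an ordered sum of s squares of integers. -/
def repSquares (s n : ℕ) : ℕ := Nat.card {x : Fin s → ℤ // ∑ i, (x i) ^ 2 = (n : ℤ)}

/-- The χ-weighted divisor function σ_k(n; χ) = ∑_{d∣n} χ(d mod N) d^k,
where χ is given by its values on residues mod N. -/
def wdiv (k N : ℕ) (χ : ℕ → ℂ) (n : ℕ) : ℂ := ∑ d ∈ n.divisors, χ (d % N) * (d : ℂ) ^ k

/-- The χ-weighted conjugate divisor function σᶜ_k(n; χ) = ∑_{d∣n} χ((n/d) mod N) d^k. -/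
def wdivc (k N : ℕ) (χ : ℕ → ℂ) (n : ℕ) : ℂ := ∑ d ∈ n.divisors, χ ((n / d) % N) * (d : ℂ) ^ k

namespace SSq
open Finset

/-- positive integer pairs with product `m` -/
def DZ (m : ℤ) : Finset (ℤ × ℤ) := (Icc 1 m ×ˢ Icc 1 m).filter (fun p => p.1 * p.2 = m)

lemma mem_DZ {m d e : ℤ} : (d, e) ∈ DZ m ↔ 0 < d ∧ 0 < e ∧ d * e = m := by
  simp only [DZ, mem_filter, mem_product, mem_Icc]
  constructor
  · rintro ⟨⟨⟨h1, h2⟩, h3, h4⟩, h5⟩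
    exact ⟨by lia, by lia, h5⟩
  · rintro ⟨h1, h2, h3⟩
    refine ⟨⟨⟨by lia, by nlinarith⟩, by lia, by nlinarith⟩, h3⟩

/-- triples `(i, d, e)` with `i² + d e = n`, `d, e > 0` -/
def S (n : ℤ) : Finset (ℤ × ℤ × ℤ) :=
  (Icc (-n) n ×ˢ Icc 1 n ×ˢ Icc 1 n).filter (fun p => p.1 ^ 2 + p.2.1 * p.2.2 = n)

lemma mem_S {n i d e : ℤ} : (i, d, e) ∈ S n ↔ 0 < d ∧ 0 < e ∧ i ^ 2 + d * e = n := by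
  simp only [S, mem_filter, mem_product, mem_Icc]
  constructor
  · rintro ⟨⟨_, ⟨h1, h2⟩, h3, h4⟩, h5⟩
    exact ⟨by lia, by lia, h5⟩
  · rintro ⟨h1, h2, h3⟩
    have h4 : 0 < d * e := mul_pos h1 h2
    have h5 : i ^ 2 ≤ n := by lia
    refine ⟨⟨⟨by nlinarith, by nlinarith⟩, ⟨by lia, by nlinarith⟩, by lia, by nlinarith⟩, h3⟩

lemma sum_S_fiber (n : ℤ) (G : ℤ → ℤ → ℤ → ℤ) :
    ∑ p ∈ S n, G p.1 p.2.1 p.2.2 = ∑ i ∈ Icc (-n) n, ∑ q ∈ DZ (n - i ^ 2), G i q.1 q.2 := by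
  rw [Finset.sum_sigma']
  refine Finset.sum_nbij' (fun p => ⟨p.1, p.2⟩) (fun p => (p.1, p.2)) ?_ ?_ ?_ ?_ ?_
  · rintro ⟨i, d, e⟩ h
    have hdd := h
    simp only [S, mem_filter, mem_product] at hdd
    rw [mem_S] at h
    simp only [mem_sigma]
    exact ⟨hdd.1.1, mem_DZ.2 ⟨h.1, h.2.1, by lia⟩⟩
  · rintro ⟨i, d, e⟩ h
    simp only [mem_sigma, mem_DZ] at h
    exact mem_S.2 ⟨h.2.1, h.2.2.1, by lia⟩
  · rintro ⟨i, d, e⟩ _; rfl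
  · rintro ⟨i, d, e⟩ _; rfl
  · rintro ⟨i, d, e⟩ _; rfl

lemma sum_neg (n : ℤ) (G : ℤ → ℤ → ℤ → ℤ) :
    ∑ p ∈ S n, G p.1 p.2.1 p.2.2 = ∑ p ∈ S n, G (-p.1) p.2.1 p.2.2 := by
  refine Finset.sum_nbij' (fun p => (-p.1, p.2)) (fun p => (-p.1, p.2)) ?_ ?_ ?_ ?_ ?_ <;>
    rintro ⟨i, d, e⟩ h <;> simp_all [mem_S]

lemma sum_swap (n : ℤ) (G : ℤ → ℤ → ℤ → ℤ) :
    ∑ p ∈ S n, G p.1 p.2.1 p.2.2 = ∑ p ∈ S n, G p.1 p.2.2 p.2.1 := by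
  refine Finset.sum_nbij' (fun p => (p.1, p.2.2, p.2.1)) (fun p => (p.1, p.2.2, p.2.1))
    ?_ ?_ ?_ ?_ ?_ <;>
    rintro ⟨i, d, e⟩ h <;> simp_all [mem_S, mul_comm]

lemma DZ_swap (n : ℤ) (G : ℤ → ℤ → ℤ) :
    ∑ p ∈ DZ n, G p.1 p.2 = ∑ p ∈ DZ n, G p.2 p.1 := by
  refine Finset.sum_nbij' (fun p => (p.2, p.1)) (fun p => (p.2, p.1)) ?_ ?_ ?_ ?_ ?_ <;>
    rintro ⟨d, e⟩ h <;> simp_all [mem_DZ, mul_comm]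

lemma DZ_dbl (n : ℤ) (c : ℤ) (hc : 0 < c) (G : ℤ → ℤ → ℤ) :
    ∑ p ∈ DZ n, (if c ∣ p.2 then G p.1 (p.2 / c) else 0)
      = ∑ p ∈ DZ n, (if c ∣ p.1 then G (p.1 / c) p.2 else 0) := by
  rw [← Finset.sum_filter, ← Finset.sum_filter]
  refine Finset.sum_nbij' (fun p => (c * p.1, p.2 / c)) (fun p => (p.1 / c, c * p.2))
    ?_ ?_ ?_ ?_ ?_
  · rintro ⟨d, e⟩ h
    simp only [mem_filter, mem_DZ] at h ⊢
    obtain ⟨⟨h1, h2, h3⟩, k, rfl⟩ := h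
    rw [Int.mul_ediv_cancel_left _ hc.ne']
    exact ⟨⟨by positivity, by exact pos_of_mul_pos_right h2 hc.le, by rw [← h3]; ring⟩,
      dvd_mul_right _ _⟩
  · rintro ⟨d, e⟩ h
    simp only [mem_filter, mem_DZ] at h ⊢
    obtain ⟨⟨h1, h2, h3⟩, k, rfl⟩ := h
    rw [Int.mul_ediv_cancel_left _ hc.ne']
    exact ⟨⟨by exact pos_of_mul_pos_right h1 hc.le, by positivity, by rw [← h3]; ring⟩,
      dvd_mul_right _ _⟩
  · rintro ⟨d, e⟩ h
    simp only [mem_filter, mem_DZ] at h ⊢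
    obtain ⟨⟨h1, h2, h3⟩, k, rfl⟩ := h
    simp [hc.ne']
  · rintro ⟨d, e⟩ h
    simp only [mem_filter, mem_DZ] at h ⊢
    obtain ⟨⟨h1, h2, h3⟩, k, rfl⟩ := h
    simp [hc.ne']
  · rintro ⟨d, e⟩ h
    simp [hc.ne']

lemma sum_dbl (n : ℤ) (G : ℤ → ℤ → ℤ → ℤ) :
    ∑ p ∈ S n, (if 2 ∣ p.2.2 then G p.1 p.2.1 (p.2.2 / 2) else 0)
      = ∑ p ∈ S n, (if 2 ∣ p.2.2 then G p.1 (p.2.2 / 2) p.2.1 else 0) := by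
  rw [sum_S_fiber n (fun i d e => if 2 ∣ e then G i d (e / 2) else 0),
    sum_S_fiber n (fun i d e => if 2 ∣ e then G i (e / 2) d else 0)]
  refine Finset.sum_congr rfl fun i _ => ?_
  rw [DZ_dbl _ 2 (by norm_num) (fun d e => G i d e)]
  exact DZ_swap _ (fun d e => if 2 ∣ d then G i (d / 2) e else 0)

/-- The Liouville identity. -/
lemma liouville (n : ℤ) (F : ℤ → ℤ → ℤ → ℤ) (hF1 : ∀ x y z, F (-x) y z = - F x y z)
    (hF2 : ∀ x y z, F x (-y) (-z) = F x y z) :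
    2 * ∑ p ∈ S n, F (p.2.2 - 2 * p.1) (p.2.1 + p.1) (2 * p.2.1 + 2 * p.1 - p.2.2)
      = ∑ p ∈ S n, F (p.2.1 + p.2.2) p.1 (p.2.1 - p.2.2)
        + 2 * ∑ p ∈ (S n).filter (fun p => p.2.2 - 2 * p.1 - p.2.1 = 0), F p.2.1 (p.2.1 + p.1) p.2.1
        - ∑ p ∈ (S n).filter (fun p => 2 * p.1 = p.2.1 - p.2.2),
            F (p.2.1 + p.2.2) p.1 (p.2.1 - p.2.2) := by
  set L : ℤ × ℤ × ℤ → ℤ :=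
    fun p => F (p.2.2 - 2 * p.1) (p.2.1 + p.1) (2 * p.2.1 + 2 * p.1 - p.2.2) with hL
  set R : ℤ × ℤ × ℤ → ℤ := fun p => F (p.2.1 + p.2.2) p.1 (p.2.1 - p.2.2) with hR
  have e1 : ∑ p ∈ S n, L p = ∑ p ∈ (S n).filter (fun p => 0 < p.2.2 - 2 * p.1 - p.2.1), L p
      + ∑ p ∈ (S n).filter (fun p => p.2.2 - 2 * p.1 - p.2.1 = 0), L p
      + ∑ p ∈ (S n).filter (fun p => p.2.2 - 2 * p.1 - p.2.1 < 0), L p := by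
    simp only [Finset.sum_filter, ← Finset.sum_add_distrib]
    refine Finset.sum_congr rfl fun p _ => ?_
    split_ifs <;> lia
  have e2 : ∑ p ∈ S n, R p = ∑ p ∈ (S n).filter (fun p => p.2.1 - p.2.2 < 2 * p.1), R p
      + ∑ p ∈ (S n).filter (fun p => 2 * p.1 = p.2.1 - p.2.2), R p
      + ∑ p ∈ (S n).filter (fun p => 2 * p.1 < p.2.1 - p.2.2), R p := by
    simp only [Finset.sum_filter, ← Finset.sum_add_distrib]
    refine Finset.sum_congr rfl fun p _ => ?_
    split_ifs <;> lia
  have e3 : ∑ p ∈ (S n).filter (fun p => 2 * p.1 < p.2.1 - p.2.2), R p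
      = ∑ p ∈ (S n).filter (fun p => p.2.1 - p.2.2 < 2 * p.1), R p := by
    refine Finset.sum_nbij' (fun p => (-p.1, p.2.2, p.2.1)) (fun p => (-p.1, p.2.2, p.2.1))
      ?_ ?_ ?_ ?_ ?_
    · rintro ⟨i, d, e⟩ h
      simp only [mem_filter, mem_S] at h ⊢
      exact ⟨⟨h.1.2.1, h.1.1, by rw [← h.1.2.2]; ring⟩, by lia⟩
    · rintro ⟨i, d, e⟩ h
      simp only [mem_filter, mem_S] at h ⊢
      exact ⟨⟨h.1.2.1, h.1.1, by rw [← h.1.2.2]; ring⟩, by lia⟩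
    · rintro ⟨i, d, e⟩ h; simp
    · rintro ⟨i, d, e⟩ h; simp
    · rintro ⟨i, d, e⟩ h
      simp only [hR]
      rw [← hF2 (e + d) (-i) (e - d), neg_neg, neg_sub, add_comm]
  have e4 : ∑ p ∈ (S n).filter (fun p => 0 < p.2.2 - 2 * p.1 - p.2.1), L p
      = ∑ p ∈ (S n).filter (fun p => p.2.1 - p.2.2 < 2 * p.1), R p := by
    refine Finset.sum_nbij' (fun p => (p.1 + p.2.1, p.2.1, p.2.2 - 2 * p.1 - p.2.1))
      (fun p => (p.1 - p.2.1, p.2.1, p.2.2 + 2 * p.1 - p.2.1))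
      ?_ ?_ ?_ ?_ ?_
    · rintro ⟨i, d, e⟩ h
      simp only [mem_filter, mem_S] at h ⊢
      exact ⟨⟨h.1.1, h.2, by rw [← h.1.2.2]; ring⟩, by lia⟩
    · rintro ⟨i, d, e⟩ h
      simp only [mem_filter, mem_S] at h ⊢
      exact ⟨⟨h.1.1, by lia, by rw [← h.1.2.2]; ring⟩, by lia⟩
    · rintro ⟨i, d, e⟩ h; simp; ring
    · rintro ⟨i, d, e⟩ h; simp; ring
    · rintro ⟨i, d, e⟩ h
      simp only [hR, hL]
      congr 1 <;> ring
  have e5 : ∑ p ∈ (S n).filter (fun p => p.2.2 - 2 * p.1 - p.2.1 < 0), L p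
      = ∑ p ∈ (S n).filter (fun p => p.2.2 - 2 * p.1 - p.2.1 < 0), - L p := by
    refine Finset.sum_nbij' (fun p => (p.2.2 - p.1, p.2.1 + 2 * p.1 - p.2.2, p.2.2))
      (fun p => (p.2.2 - p.1, p.2.1 + 2 * p.1 - p.2.2, p.2.2))
      ?_ ?_ ?_ ?_ ?_
    · rintro ⟨i, d, e⟩ h
      simp only [mem_filter, mem_S] at h ⊢
      exact ⟨⟨by lia, h.1.2.1, by rw [← h.1.2.2]; ring⟩, by lia⟩
    · rintro ⟨i, d, e⟩ h
      simp only [mem_filter, mem_S] at h ⊢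
      exact ⟨⟨by lia, h.1.2.1, by rw [← h.1.2.2]; ring⟩, by lia⟩
    · rintro ⟨i, d, e⟩ h; simp; ring
    · rintro ⟨i, d, e⟩ h; simp; ring
    · rintro ⟨i, d, e⟩ h
      simp only [hL]
      rw [← hF1]
      congr 1 <;> ring
  have e6 : ∑ p ∈ (S n).filter (fun p => p.2.2 - 2 * p.1 - p.2.1 = 0), L p
      = ∑ p ∈ (S n).filter (fun p => p.2.2 - 2 * p.1 - p.2.1 = 0), F p.2.1 (p.2.1 + p.1) p.2.1 := by
    refine Finset.sum_congr rfl ?_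
    rintro ⟨i, d, e⟩ h
    simp only [mem_filter, mem_S, hL] at h ⊢
    congr 1 <;> lia
  rw [Finset.sum_neg_distrib] at e5
  linarith

lemma liouville_nonsq (n : ℤ) (hn : ∀ t : ℤ, t ^ 2 ≠ n) (F : ℤ → ℤ → ℤ → ℤ)
    (hF1 : ∀ x y z, F (-x) y z = - F x y z)
    (hF2 : ∀ x y z, F x (-y) (-z) = F x y z) :
    2 * ∑ p ∈ S n, F (p.2.2 - 2 * p.1) (p.2.1 + p.1) (2 * p.2.1 + 2 * p.1 - p.2.2)
      = ∑ p ∈ S n, F (p.2.1 + p.2.2) p.1 (p.2.1 - p.2.2) := by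
  rw [liouville n F hF1 hF2]
  rw [Finset.filter_false_of_mem, Finset.filter_false_of_mem]
  · simp
  · rintro ⟨i, d, e⟩ h h2
    rw [mem_S] at h
    simp only at h2
    refine hn (d - i) ?_
    rw [← h.2.2, show e = d - 2 * i by lia]; ring
  · rintro ⟨i, d, e⟩ h h2
    rw [mem_S] at h
    simp only at h2
    refine hn (d + i) ?_
    rw [← h.2.2, show e = d + 2 * i by lia]; ring

lemma sum_Ioo_even (t : ℕ) (ht : 0 < t) (g : ℤ → ℤ) (hg : ∀ j, g (-j) = g j) :
    ∑ j ∈ Ioo (-(t : ℤ)) t, g j = 2 * ∑ j ∈ range t, g j - g 0 := by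
  rw [← Finset.sum_filter_add_sum_filter_not _ (fun j : ℤ => 0 ≤ j)]
  have h1 : ∑ j ∈ (Ioo (-(t : ℤ)) t).filter (fun j : ℤ => 0 ≤ j), g j = ∑ j ∈ range t, g j := by
    refine Finset.sum_nbij' (fun j => j.toNat) (fun j => (j : ℤ)) ?_ ?_ ?_ ?_ ?_
    · intro j h; simp only [mem_filter, mem_Ioo, mem_range] at h ⊢; lia
    · intro j h; simp only [mem_filter, mem_Ioo, mem_range] at h ⊢; lia
    · intro j h; simp only [mem_filter, mem_Ioo] at h ⊢; lia
    · intro j h; simp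
    · intro j h; simp only [mem_filter, mem_Ioo] at h ⊢; congr 1; lia
  have h2 : ∑ j ∈ (Ioo (-(t : ℤ)) t).filter (fun j : ℤ => ¬ 0 ≤ j), g j
      = ∑ j ∈ (range t).erase 0, g j := by
    refine Finset.sum_nbij' (fun j => (-j).toNat) (fun j => -(j : ℤ)) ?_ ?_ ?_ ?_ ?_
    · intro j h; simp only [mem_filter, mem_Ioo, mem_range, mem_erase] at h ⊢; lia
    · intro j h; simp only [mem_filter, mem_Ioo, mem_range, mem_erase] at h ⊢; lia
    · intro j h; simp only [mem_filter, mem_Ioo] at h ⊢; lia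
    · intro j h; simp
    · intro j h
      simp only [mem_filter, mem_Ioo] at h ⊢
      rw [← hg]; congr 1; lia
  have h3 := Finset.add_sum_erase (range t) (fun j : ℕ => g j) (mem_range.2 ht)
  simp only [Nat.cast_zero] at h3
  rw [h1, h2]; lia

lemma liouville_sq (t : ℕ) (ht : 0 < t) (F : ℤ → ℤ → ℤ → ℤ)
    (hF1 : ∀ x y z, F (-x) y z = - F x y z)
    (hF2 : ∀ x y z, F x (-y) (-z) = F x y z) :
    2 * ∑ p ∈ S ((t : ℤ) ^ 2), F (p.2.2 - 2 * p.1) (p.2.1 + p.1) (2 * p.2.1 + 2 * p.1 - p.2.2)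
      = ∑ p ∈ S ((t : ℤ) ^ 2), F (p.2.1 + p.2.2) p.1 (p.2.1 - p.2.2)
        + 2 * ∑ j ∈ range (2 * t), F j t j
        - (2 * ∑ j ∈ range t, F (2 * t) j (2 * j) - F (2 * t) 0 0) := by
  rw [liouville _ F hF1 hF2]
  have e1 : ∑ p ∈ (S ((t : ℤ) ^ 2)).filter (fun p => p.2.2 - 2 * p.1 - p.2.1 = 0),
      F p.2.1 (p.2.1 + p.1) p.2.1 = ∑ j ∈ range (2 * t), F j t j := by
    have h0 : F ((0 : ℕ) : ℤ) t ((0 : ℕ) : ℤ) = 0 := by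
      have := hF1 0 t 0
      simp at this ⊢; lia
    have : ∑ j ∈ range (2 * t), F j t j = ∑ j ∈ (range (2 * t)).erase 0, F j t j := by
      exact (Finset.sum_erase (f := fun j : ℕ => F j t j) _ h0).symm
    rw [this]
    refine Finset.sum_nbij' (fun p => p.2.1.toNat) (fun j => ((t : ℤ) - j, (j : ℤ), 2 * (t : ℤ) - j))
      ?_ ?_ ?_ ?_ ?_
    · rintro ⟨i, d, e⟩ h
      simp only [mem_filter, mem_S, mem_erase, mem_range] at h ⊢
      obtain ⟨⟨h1, h2, h3⟩, h4⟩ := h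
      have h5 : e = d + 2 * i := by lia
      have h6 : (i + d) ^ 2 = (t : ℤ) ^ 2 := by rw [← h3, h5]; ring
      rcases sq_eq_sq_iff_eq_or_eq_neg.1 h6 with h7 | h7 <;> lia
    · intro j h
      simp only [mem_filter, mem_S, mem_erase, mem_range] at h ⊢
      exact ⟨⟨by lia, by lia, by ring⟩, by ring⟩
    · rintro ⟨i, d, e⟩ h
      simp only [mem_filter, mem_S] at h ⊢
      obtain ⟨⟨h1, h2, h3⟩, h4⟩ := h
      have h5 : e = d + 2 * i := by lia
      have h6 : (i + d) ^ 2 = (t : ℤ) ^ 2 := by rw [← h3, h5]; ring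
      rcases sq_eq_sq_iff_eq_or_eq_neg.1 h6 with h7 | h7
      · ext <;> simp <;> lia
      · lia
    · intro j h
      simp
    · rintro ⟨i, d, e⟩ h
      simp only [mem_filter, mem_S] at h ⊢
      obtain ⟨⟨h1, h2, h3⟩, h4⟩ := h
      have h5 : e = d + 2 * i := by lia
      have h6 : (i + d) ^ 2 = (t : ℤ) ^ 2 := by rw [← h3, h5]; ring
      rcases sq_eq_sq_iff_eq_or_eq_neg.1 h6 with h7 | h7
      · congr 1 <;> lia
      · lia
  have e2 : ∑ p ∈ (S ((t : ℤ) ^ 2)).filter (fun p => 2 * p.1 = p.2.1 - p.2.2),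
      F (p.2.1 + p.2.2) p.1 (p.2.1 - p.2.2)
      = 2 * ∑ j ∈ range t, F (2 * t) j (2 * j) - F (2 * t) 0 0 := by
    have h := sum_Ioo_even t ht (fun j => F (2 * t) j (2 * j)) (fun j => by
      rw [← hF2]; congr 1 <;> ring)
    simp only [mul_zero] at h
    rw [← h]
    have key : ∀ i d e : ℤ, 0 < d → 0 < e → i ^ 2 + d * e = (t : ℤ) ^ 2 → 2 * i = d - e →
        d = t + i ∧ e = t - i := by
      intro i d e h1 h2 h3 h4
      have h5 : e = d - 2 * i := by lia
      have h6 : (d - i) ^ 2 = (t : ℤ) ^ 2 := by rw [← h3, h5]; ring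
      rcases sq_eq_sq_iff_eq_or_eq_neg.1 h6 with h7 | h7 <;> lia
    refine Finset.sum_nbij' (fun p => p.1) (fun j => (j, (t : ℤ) + j, (t : ℤ) - j))
      ?_ ?_ ?_ ?_ ?_
    · rintro ⟨i, d, e⟩ h
      simp only [mem_filter, mem_S, mem_Ioo] at h ⊢
      have := key i d e h.1.1 h.1.2.1 h.1.2.2 h.2
      lia
    · intro j h
      simp only [mem_filter, mem_S, mem_Ioo] at h ⊢
      exact ⟨⟨by lia, by lia, by ring⟩, by ring⟩
    · rintro ⟨i, d, e⟩ h
      simp only [mem_filter, mem_S] at h ⊢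
      have := key i d e h.1.1 h.1.2.1 h.1.2.2 h.2
      rw [this.1, this.2]
    · intro j h
      rfl
    · rintro ⟨i, d, e⟩ h
      simp only [mem_filter, mem_S] at h ⊢
      have := key i d e h.1.1 h.1.2.1 h.1.2.2 h.2
      congr 1 <;> lia
  rw [e1, e2]

/-- integer vectors with squared norm `m` -/
def V (s : ℕ) (m : ℤ) : Finset (Fin s → ℤ) :=
  (Fintype.piFinset fun _ : Fin s => Icc (-m) m).filter (fun v => ∑ i, v i ^ 2 = m)

lemma mem_V {s : ℕ} {m : ℤ} {v : Fin s → ℤ} : v ∈ V s m ↔ ∑ i, v i ^ 2 = m := by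
  simp only [V, mem_filter, Fintype.mem_piFinset, mem_Icc, and_iff_right_iff_imp]
  intro h i
  have h1 : v i ^ 2 ≤ m := by
    rw [← h]
    exact Finset.single_le_sum (f := fun i => v i ^ 2) (fun _ _ => sq_nonneg _) (mem_univ i)
  constructor <;> nlinarith

lemma repSquares_eq (s n : ℕ) : repSquares s n = (V s n).card := by
  rw [repSquares]
  exact Nat.subtype_card _ (fun v => mem_V)

lemma V_sum_coord (s : ℕ) (n : ℤ) (j : Fin (s + 1)) :
    ∑ v ∈ V (s + 1) n, v j ^ 2 = ∑ v ∈ V (s + 1) n, v 0 ^ 2 := by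
  have hm : ∀ v ∈ V (s + 1) n, v ∘ Equiv.swap 0 j ∈ V (s + 1) n := by
    intro v hv
    rw [mem_V] at hv ⊢
    rw [← hv]
    exact Equiv.sum_comp (Equiv.swap 0 j) (fun i => v i ^ 2)
  refine Finset.sum_nbij' (fun v => v ∘ Equiv.swap 0 j) (fun v => v ∘ Equiv.swap 0 j) hm hm ?_ ?_ ?_
  · intro v _; ext i; simp
  · intro v _; ext i; simp
  · intro v _; simp

lemma V_rec (s : ℕ) (n : ℤ) :
    ∑ x ∈ Icc (-n) n, (n - (s + 1) * x ^ 2) * ((V s (n - x ^ 2)).card : ℤ) = 0 := by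
  have h1 : ∑ v ∈ V (s + 1) n, (n - (s + 1) * v 0 ^ 2) = 0 := by
    have h2 : ∑ v ∈ V (s + 1) n, n = ∑ v ∈ V (s + 1) n, ∑ j, v j ^ 2 :=
      Finset.sum_congr rfl fun v hv => (mem_V.1 hv).symm
    rw [Finset.sum_sub_distrib, h2, Finset.sum_comm, ← Finset.mul_sum]
    simp only [V_sum_coord]
    simp
  rw [← h1]
  have h3 : ∑ x ∈ Icc (-n) n, (n - (s + 1) * x ^ 2) * ((V s (n - x ^ 2)).card : ℤ)
      = ∑ x ∈ Icc (-n) n, ∑ v ∈ V s (n - x ^ 2), (n - (s + 1) * x ^ 2) :=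
    Finset.sum_congr rfl fun x _ => by rw [Finset.sum_const, nsmul_eq_mul, mul_comm]
  rw [h3, Finset.sum_sigma']
  refine Finset.sum_nbij' (fun p => Fin.cons p.1 p.2) (fun v => ⟨v 0, Fin.tail v⟩) ?_ ?_ ?_ ?_ ?_
  · rintro ⟨x, v⟩ h
    simp only [mem_sigma, mem_V] at h ⊢
    rw [Fin.sum_univ_succ]
    simp [h.2]
  · intro v h
    have hdd := h
    simp only [V, mem_filter, Fintype.mem_piFinset] at hdd
    rw [mem_V, Fin.sum_univ_succ] at h
    simp only [mem_sigma, mem_V]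
    refine ⟨hdd.1 0, ?_⟩
    simp only [Fin.tail]
    lia
  · rintro ⟨x, v⟩ h; simp
  · intro v h; simp
  · rintro ⟨x, v⟩ h; simp

lemma card_V_neg (s : ℕ) (m : ℤ) (hm : m < 0) : (V s m).card = 0 := by
  rw [Finset.card_eq_zero, Finset.eq_empty_iff_forall_notMem]
  intro v hv
  rw [mem_V] at hv
  have : 0 ≤ ∑ i, v i ^ 2 := Finset.sum_nonneg fun _ _ => sq_nonneg _
  lia

lemma card_V_zero (s : ℕ) : (V s 0).card = 1 := by
  rw [Finset.card_eq_one]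
  refine ⟨0, ?_⟩
  ext v
  rw [mem_V, mem_singleton, Finset.sum_eq_zero_iff_of_nonneg fun _ _ => sq_nonneg _]
  simp [funext_iff]

lemma main_step (s : ℕ) (w : ℤ → ℤ → ℤ)
    (h1 : ∀ n : ℤ, 0 < n → (∀ t : ℤ, t ^ 2 ≠ n) →
      ∑ p ∈ S n, w p.2.1 p.2.2 * (p.2.1 * p.2.2 - s * p.1 ^ 2) = 0)
    (h2 : ∀ t : ℕ, 0 < t →
      ∑ p ∈ S ((t : ℤ) ^ 2), w p.2.1 p.2.2 * (p.2.1 * p.2.2 - s * p.1 ^ 2) = 2 * s * (t : ℤ) ^ 2)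
    (n : ℕ) (hn : 0 < n) : ((V s n).card : ℤ) = ∑ q ∈ DZ n, w q.1 q.2 := by
  set f : ℤ → ℤ := fun m => if m = 0 then 1 else ∑ q ∈ DZ m, w q.1 q.2 with hf
  have hrec : ∀ n : ℤ, 0 < n → ∑ x ∈ Icc (-n) n, (n - (s + 1) * x ^ 2) * f (n - x ^ 2) = 0 := by
    intro n hn
    have e1 : ∀ x ∈ Icc (-n) n, (n - (s + 1) * x ^ 2) * f (n - x ^ 2)
        = ∑ q ∈ DZ (n - x ^ 2), w q.1 q.2 * (q.1 * q.2 - s * x ^ 2)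
          + if x ^ 2 = n then - (s : ℤ) * n else 0 := by
      intro x _
      have e2 : ∑ q ∈ DZ (n - x ^ 2), w q.1 q.2 * (q.1 * q.2 - s * x ^ 2)
          = (n - (s + 1) * x ^ 2) * ∑ q ∈ DZ (n - x ^ 2), w q.1 q.2 := by
        rw [Finset.mul_sum]
        refine Finset.sum_congr rfl ?_
        rintro ⟨d, e⟩ hq
        rw [mem_DZ] at hq
        simp only
        rw [hq.2.2]; ring
      rw [e2]
      by_cases hx : x ^ 2 = n
      · have : DZ 0 = ∅ := by simp [DZ]
        simp [hf, hx, this]; ring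
      · have : n - x ^ 2 ≠ 0 := by lia
        simp [hf, hx, this]
    rw [Finset.sum_congr rfl e1, Finset.sum_add_distrib,
      ← sum_S_fiber n (fun i d e => w d e * (d * e - s * i ^ 2))]
    by_cases hsq : ∃ t : ℤ, t ^ 2 = n
    · obtain ⟨t, rfl⟩ := hsq
      obtain ⟨k, hk⟩ : ∃ k : ℕ, t ^ 2 = (k : ℤ) ^ 2 := ⟨t.natAbs, by simp⟩
      rw [hk] at hn ⊢
      have hk0 : 0 < k := by
        rcases Nat.eq_zero_or_pos k with h | h
        · simp [h] at hn
        · exact h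
      rw [h2 k hk0, ← Finset.sum_filter]
      have : (Icc (-(k : ℤ) ^ 2) ((k : ℤ) ^ 2)).filter (fun x => x ^ 2 = (k : ℤ) ^ 2)
          = {(k : ℤ), -(k : ℤ)} := by
        ext x
        simp only [mem_filter, mem_Icc, mem_insert, mem_singleton]
        constructor
        · rintro ⟨_, h⟩
          exact sq_eq_sq_iff_eq_or_eq_neg.1 h
        · have : (1 : ℤ) ≤ k := by lia
          rintro (rfl | rfl)
          · exact ⟨⟨by nlinarith, by nlinarith⟩, rfl⟩
          · exact ⟨⟨by nlinarith, by nlinarith⟩, by ring⟩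
      rw [this, Finset.sum_pair (by lia)]
      ring
    · push Not at hsq
      rw [h1 n hn hsq, zero_add]
      exact Finset.sum_eq_zero fun x _ => by simp [hsq x]
  have hind : ∀ m : ℕ, ((V s m).card : ℤ) = f m := by
    intro m
    induction m using Nat.strong_induction_on with
    | _ m ih =>
      rcases Nat.eq_zero_or_pos m with rfl | hm
      · simp [card_V_zero, hf]
      have a1 := hrec m (by lia)
      have a2 := V_rec s m
      have h0 : (0 : ℤ) ∈ Icc (-(m : ℤ)) m := by simp
      rw [← Finset.add_sum_erase _ _ h0] at a1 a2
      have a3 : ∑ x ∈ (Icc (-(m : ℤ)) m).erase 0,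
            ((m : ℤ) - (s + 1) * x ^ 2) * ((V s (m - x ^ 2)).card : ℤ)
          = ∑ x ∈ (Icc (-(m : ℤ)) m).erase 0, ((m : ℤ) - (s + 1) * x ^ 2) * f (m - x ^ 2) := by
        refine Finset.sum_congr rfl fun x hx => ?_
        rw [mem_erase] at hx
        have hx1 := hx.1
        have hx2 : 0 < x ^ 2 := by positivity
        congr 1
        rcases lt_or_ge ((m : ℤ) - x ^ 2) 0 with h | h
        · rw [card_V_neg _ _ h]
          have : DZ ((m : ℤ) - x ^ 2) = ∅ := by
            simp only [DZ]
            rw [Finset.Icc_eq_empty (by lia)]; simp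
          simp [hf, h.ne, this]
        · obtain ⟨k, hk⟩ := Int.eq_ofNat_of_zero_le h
          rw [hk]
          exact ih k (by lia)
      rw [a3] at a2
      have a4 : (m : ℤ) * ((V s m).card : ℤ) = m * f m := by
        simp at a1 a2
        linarith
      exact mul_left_cancel₀ (by lia) a4
  rw [hind n, hf]
  simp [hn.ne']

def chi (z : ℤ) : ℤ := if z % 4 = 1 then 1 else if z % 4 = 3 then -1 else 0
def eps (y : ℤ) : ℤ := if y % 2 = 0 then 1 else -1

lemma chi_neg (z : ℤ) : chi (-z) = - chi z := by
  unfold chi; split_ifs <;> lia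
lemma eps_neg (z : ℤ) : eps (-z) = eps z := by
  unfold eps; split_ifs <;> lia
lemma eps_add (a b : ℤ) : eps (a + b) = eps a * eps b := by
  unfold eps; split_ifs <;> lia
lemma eps_mul_self (a : ℤ) : eps a * eps a = 1 := by
  unfold eps; split_ifs <;> lia
lemma eps_sq (a : ℤ) : eps (a ^ 2) = eps a := by
  unfold eps
  rcases Int.emod_two_eq_zero_or_one a with h | h <;> simp [pow_two, Int.mul_emod, h]
lemma chi_eps (a e : ℤ) : chi (2 * a - e) * eps a = - chi e := by
  unfold chi eps; split_ifs <;> lia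

lemma anti_swap (n : ℤ) (G : ℤ → ℤ → ℤ → ℤ) (h : ∀ i d e, G i e d = - G i d e) :
    ∑ p ∈ S n, G p.1 p.2.1 p.2.2 = 0 := by
  have h1 := sum_swap n G
  have h2 : ∑ p ∈ S n, G p.1 p.2.2 p.2.1 = - ∑ p ∈ S n, G p.1 p.2.1 p.2.2 := by
    rw [← Finset.sum_neg_distrib]
    exact Finset.sum_congr rfl fun p _ => h p.1 p.2.1 p.2.2
  lia

lemma anti_neg (n : ℤ) (G : ℤ → ℤ → ℤ → ℤ) (h : ∀ i d e, G (-i) d e = - G i d e) :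
    ∑ p ∈ S n, G p.1 p.2.1 p.2.2 = 0 := by
  have h1 := sum_neg n G
  simp only [h, Finset.sum_neg_distrib] at h1
  lia

lemma anti_dbl (n : ℤ) (G : ℤ → ℤ → ℤ → ℤ) (h : ∀ i d e, G i e d = - G i d e) :
    ∑ p ∈ S n, (if 2 ∣ p.2.2 then G p.1 p.2.1 (p.2.2 / 2) else 0) = 0 := by
  have h1 := sum_dbl n G
  have h2 : ∑ p ∈ S n, (if 2 ∣ p.2.2 then G p.1 (p.2.2 / 2) p.2.1 else 0)
      = - ∑ p ∈ S n, (if 2 ∣ p.2.2 then G p.1 p.2.1 (p.2.2 / 2) else 0) := by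
    rw [← Finset.sum_neg_distrib]
    refine Finset.sum_congr rfl fun p _ => ?_
    split_ifs
    · exact h _ _ _
    · simp
  lia

/-! ### two and six squares -/

lemma chi_L (n : ℤ) (P : ℤ → ℤ → ℤ) :
    ∑ p ∈ S n, chi (2 * p.2.1 + 2 * p.1 - p.2.2) * eps (p.2.1 + p.1)
        * P (p.2.2 - 2 * p.1) (p.2.1 + p.1)
      = - ∑ p ∈ S n, chi p.2.2 * P (p.2.2 - 2 * p.1) (p.2.1 + p.1) := by
  rw [← Finset.sum_neg_distrib]
  refine Finset.sum_congr rfl fun p _ => ?_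
  rw [← mul_add, chi_eps]; ring

lemma chi_R (n : ℤ) (P : ℤ → ℤ → ℤ) (hP2 : ∀ x y, P x (-y) = - P x y) :
    ∑ p ∈ S n, chi (p.2.1 - p.2.2) * eps p.1 * P (p.2.1 + p.2.2) p.1 = 0 :=
  anti_neg n (fun i d e => chi (d - e) * eps i * P (d + e) i) fun i d e => by
    simp only [hP2, eps_neg]; ring

lemma chi_case_nonsq (P : ℤ → ℤ → ℤ) (hP1 : ∀ x y, P (-x) y = - P x y)
    (hP2 : ∀ x y, P x (-y) = - P x y) (n : ℤ) (hn : ∀ t : ℤ, t ^ 2 ≠ n) :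
    ∑ p ∈ S n, chi p.2.2 * P (p.2.2 - 2 * p.1) (p.2.1 + p.1) = 0 := by
  have h := liouville_nonsq n hn (fun x y z => chi z * eps y * P x y)
    (fun x y z => by simp only [hP1]; ring)
    (fun x y z => by simp only [hP2, chi_neg, eps_neg]; ring)
  simp only [chi_L n P, chi_R n P hP2] at h
  lia

lemma chi_case_sq (P : ℤ → ℤ → ℤ) (hP1 : ∀ x y, P (-x) y = - P x y)
    (hP2 : ∀ x y, P x (-y) = - P x y) (t : ℕ) (ht : 0 < t) :
    ∑ p ∈ S ((t : ℤ) ^ 2), chi p.2.2 * P (p.2.2 - 2 * p.1) (p.2.1 + p.1)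
      = - ∑ j ∈ range (2 * t), chi j * eps t * P j t := by
  have h := liouville_sq t ht (fun x y z => chi z * eps y * P x y)
    (fun x y z => by simp only [hP1]; ring)
    (fun x y z => by simp only [hP2, chi_neg, eps_neg]; ring)
  have h0 : ∀ j : ℤ, chi (2 * j) = 0 := by
    intro j; unfold chi; split_ifs <;> lia
  have h00 : chi 0 = 0 := by decide
  simp only [chi_L _ P, chi_R _ P hP2, h0, h00] at h
  simp at h
  lia

lemma chi_even (n : ℤ) (P : ℤ → ℤ → ℤ) :
    2 * ∑ p ∈ S n, chi p.2.2 * P (p.2.2 - 2 * p.1) (p.2.1 + p.1)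
      = ∑ p ∈ S n, chi p.2.2 * (P (p.2.2 - 2 * p.1) (p.2.1 + p.1)
          + P (p.2.2 + 2 * p.1) (p.2.1 - p.1)) := by
  have h := sum_neg n (fun i d e => chi e * P (e - 2 * i) (d + i))
  simp only [mul_add, Finset.sum_add_distrib]
  rw [two_mul]
  congr 1
  rw [h]
  refine Finset.sum_congr rfl fun p _ => ?_
  congr 2 <;> ring

lemma chi_even1 (m : ℤ) : chi (2 * m) = 0 := by
  unfold chi; split_ifs <;> lia
lemma chi_odd1 (m : ℤ) : chi (2 * m + 1) = eps m := by
  unfold chi eps; split_ifs <;> lia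
lemma eps_succ (m : ℤ) : eps (m + 1) = - eps m := by
  unfold eps; split_ifs <;> lia

lemma sum_chi1 (m : ℕ) : ∑ j ∈ range (2 * m), chi j * (j : ℤ) = - eps m * m := by
  induction m with
  | zero => simp
  | succ m ih =>
    rw [show 2 * (m + 1) = 2 * m + 1 + 1 by ring, Finset.sum_range_succ, Finset.sum_range_succ, ih]
    push_cast
    rw [chi_even1, chi_odd1, eps_succ]; ring

lemma sum_chi3 (m : ℕ) :
    ∑ j ∈ range (2 * m), chi j * (j : ℤ) ^ 3 = - eps m * (4 * (m : ℤ) ^ 3 - 3 * m) := by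
  induction m with
  | zero => simp
  | succ m ih =>
    rw [show 2 * (m + 1) = 2 * m + 1 + 1 by ring, Finset.sum_range_succ, Finset.sum_range_succ, ih]
    push_cast
    rw [chi_even1, chi_odd1, eps_succ]; ring

lemma two_squares (n : ℕ) (hn : 0 < n) :
    ((V 2 n).card : ℤ) = ∑ q ∈ DZ n, 4 * chi q.2 := by
  have key : ∀ n : ℤ, ∑ p ∈ S n, 4 * chi p.2.2 * (p.2.1 * p.2.2 - (2 : ℕ) * p.1 ^ 2)
      = 4 * ∑ p ∈ S n, chi p.2.2 * ((p.2.2 - 2 * p.1) * (p.2.1 + p.1)) := by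
    intro n
    have h := chi_even n (fun x y => x * y)
    have : ∑ p ∈ S n, 4 * chi p.2.2 * (p.2.1 * p.2.2 - (2 : ℕ) * p.1 ^ 2)
      = 2 * ∑ p ∈ S n, chi p.2.2 * ((p.2.2 - 2 * p.1) * (p.2.1 + p.1)
          + (p.2.2 + 2 * p.1) * (p.2.1 - p.1)) := by
      rw [Finset.mul_sum]
      refine Finset.sum_congr rfl fun p _ => ?_
      push_cast; ring
    rw [this, ← h]; ring
  refine main_step 2 (fun d e => 4 * chi e) ?_ ?_ n hn
  · intro n hn hsq
    rw [key, chi_case_nonsq (fun x y => x * y) (by intros; ring) (by intros; ring) n hsq]; simp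
  · intro t ht
    rw [key, chi_case_sq (fun x y => x * y) (by intros; ring) (by intros; ring) t ht]
    have h1 : ∑ j ∈ range (2 * t), chi j * eps t * ((j : ℤ) * t)
        = eps t * t * ∑ j ∈ range (2 * t), chi j * (j : ℤ) := by
      rw [Finset.mul_sum]
      refine Finset.sum_congr rfl fun p _ => ?_
      ring
    rw [h1, sum_chi1]
    have := eps_mul_self t
    push_cast
    linear_combination (4 * (t : ℤ) ^ 2) * this

lemma six_squares (n : ℕ) (hn : 0 < n) :
    ((V 6 n).card : ℤ) = ∑ q ∈ DZ n, 4 * chi q.2 * (4 * q.1 ^ 2 - q.2 ^ 2) := by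
  have key : ∀ n : ℤ, ∑ p ∈ S n, 4 * chi p.2.2 * (4 * p.2.1 ^ 2 - p.2.2 ^ 2)
        * (p.2.1 * p.2.2 - (6 : ℕ) * p.1 ^ 2)
      = 4 * ∑ p ∈ S n, chi p.2.2 * (4 * (p.2.2 - 2 * p.1) * (p.2.1 + p.1) ^ 3
          - (p.2.2 - 2 * p.1) ^ 3 * (p.2.1 + p.1)) := by
    intro n
    have h := chi_even n (fun x y => 4 * x * y ^ 3 - x ^ 3 * y)
    have : ∑ p ∈ S n, 4 * chi p.2.2 * (4 * p.2.1 ^ 2 - p.2.2 ^ 2)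
        * (p.2.1 * p.2.2 - (6 : ℕ) * p.1 ^ 2)
      = 2 * ∑ p ∈ S n, chi p.2.2 * ((4 * (p.2.2 - 2 * p.1) * (p.2.1 + p.1) ^ 3
          - (p.2.2 - 2 * p.1) ^ 3 * (p.2.1 + p.1))
          + (4 * (p.2.2 + 2 * p.1) * (p.2.1 - p.1) ^ 3
          - (p.2.2 + 2 * p.1) ^ 3 * (p.2.1 - p.1))) := by
      rw [Finset.mul_sum]
      refine Finset.sum_congr rfl fun p _ => ?_
      push_cast; ring
    rw [this, ← h]; ring
  refine main_step 6 (fun d e => 4 * chi e * (4 * d ^ 2 - e ^ 2)) ?_ ?_ n hn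
  · intro n hn hsq
    rw [key, chi_case_nonsq (fun x y => 4 * x * y ^ 3 - x ^ 3 * y) (by intros; ring)
      (by intros; ring) n hsq]; simp
  · intro t ht
    rw [key, chi_case_sq (fun x y => 4 * x * y ^ 3 - x ^ 3 * y) (by intros; ring)
      (by intros; ring) t ht]
    have h1 : ∑ j ∈ range (2 * t), chi j * eps t * (4 * (j : ℤ) * t ^ 3 - j ^ 3 * t)
        = 4 * eps t * t ^ 3 * ∑ j ∈ range (2 * t), chi j * (j : ℤ)
          - eps t * t * ∑ j ∈ range (2 * t), chi j * (j : ℤ) ^ 3 := by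
      rw [Finset.mul_sum, Finset.mul_sum, ← Finset.sum_sub_distrib]
      refine Finset.sum_congr rfl fun p _ => ?_
      ring
    rw [h1, sum_chi1, sum_chi3]
    have := eps_mul_self t
    push_cast
    linear_combination (12 * (t : ℤ) ^ 2) * this

/-! ### four squares -/

/-- parity weight: `-1` iff `d` odd and `e` even -/
def eta (d e : ℤ) : ℤ := if d % 2 = 1 ∧ e % 2 = 0 then -1 else 1
def odd1 (x : ℤ) : ℤ := if x % 2 = 0 then 0 else 1

lemma eps_eta (i d e : ℤ) : eps (i ^ 2 + d * e + (d + i)) = eta d e := by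
  unfold eps eta
  rcases Int.emod_two_eq_zero_or_one i with h | h <;>
  rcases Int.emod_two_eq_zero_or_one d with hdd | hdd <;>
  rcases Int.emod_two_eq_zero_or_one e with hee | hee <;>
  simp [pow_two, Int.add_emod, Int.mul_emod, h, hdd, hee]

def F4 (n x y z : ℤ) : ℤ := x * y * z * (odd1 x + 1 - eps (n + y))

lemma odd1_neg (x : ℤ) : odd1 (-x) = odd1 x := by
  unfold odd1; split_ifs <;> lia

lemma eps_add_neg (n y : ℤ) : eps (n + -y) = eps (n + y) := by
  rw [eps_add, eps_add, eps_neg]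

lemma F4_R (n : ℤ) : ∑ p ∈ S n, F4 n (p.2.1 + p.2.2) p.1 (p.2.1 - p.2.2) = 0 :=
  anti_neg n (fun i d e => F4 n (d + e) i (d - e)) fun i d e => by
    simp only [F4, eps_add_neg]; ring

def w4 (d e : ℤ) : ℤ := if 4 ∣ e then 0 else 8 * e

lemma F4_L (n : ℤ) : ∑ p ∈ S n, w4 p.2.1 p.2.2 * (p.2.1 * p.2.2 - (4 : ℕ) * p.1 ^ 2)
    = 8 * ∑ p ∈ S n, F4 n (p.2.2 - 2 * p.1) (p.2.1 + p.1) (2 * p.2.1 + 2 * p.1 - p.2.2) := by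
  have a1 := sum_neg n (fun i d e => F4 n (e - 2 * i) (d + i) (2 * d + 2 * i - e))
  have a2 := anti_dbl n (fun i d h => odd1 d * (2 * d * (2 * d * h - 4 * i ^ 2))
    - odd1 h * (2 * h * (2 * d * h - 4 * i ^ 2))) (by intros; ring)
  have a3 := anti_swap n (fun i d e => (if d % 2 = 0 ∧ e % 2 = 0 then 0 else 1) *
    ((d - e) * (d * e - 4 * i ^ 2))) (by
      intro i d e
      simp only [and_comm (a := e % 2 = 0)]
      ring)
  have a4 : ∑ p ∈ S n, (2 * (w4 p.2.1 p.2.2 * (p.2.1 * p.2.2 - (4 : ℕ) * p.1 ^ 2))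
      + 16 * (if 2 ∣ p.2.2 then (odd1 p.2.1 * (2 * p.2.1 * (2 * p.2.1 * (p.2.2 / 2) - 4 * p.1 ^ 2))
        - odd1 (p.2.2 / 2) * (2 * (p.2.2 / 2) * (2 * p.2.1 * (p.2.2 / 2) - 4 * p.1 ^ 2))) else 0)
      + 32 * ((if p.2.1 % 2 = 0 ∧ p.2.2 % 2 = 0 then 0 else 1) *
          ((p.2.1 - p.2.2) * (p.2.1 * p.2.2 - 4 * p.1 ^ 2))))
      = ∑ p ∈ S n, (8 * F4 n (p.2.2 - 2 * p.1) (p.2.1 + p.1) (2 * p.2.1 + 2 * p.1 - p.2.2)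
      + 8 * F4 n (p.2.2 - 2 * -p.1) (p.2.1 + -p.1) (2 * p.2.1 + 2 * -p.1 - p.2.2)) := by
    refine Finset.sum_congr rfl ?_
    rintro ⟨i, d, e⟩ hp
    rw [mem_S] at hp
    have b1 : eps (n + (d + i)) = eta d e := by rw [← hp.2.2]; exact eps_eta i d e
    have b2 : eps (n + (d + -i)) = eta d e := by
      rw [← hp.2.2, ← neg_sq]; exact eps_eta (-i) d e
    have b3 : odd1 (e - 2 * i) = odd1 e := by unfold odd1; split_ifs <;> lia
    have b4 : odd1 (e - 2 * -i) = odd1 e := by unfold odd1; split_ifs <;> lia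
    simp only [F4, b1, b2, b3, b4]
    clear b1 b2 b3 b4 hp a1 a2 a3
    rcases Int.emod_two_eq_zero_or_one e with he | he
    · obtain ⟨h, rfl⟩ : (2 : ℤ) ∣ e := by lia
      have c1 : 2 * h / 2 = h := by lia
      have c2 : (4 ∣ 2 * h) ↔ h % 2 = 0 := by lia
      simp only [w4, eta, odd1, c1, c2, he, dvd_mul_right]
      rcases Int.emod_two_eq_zero_or_one h with hh | hh <;>
      rcases Int.emod_two_eq_zero_or_one d with hd | hd <;>
      simp [hh, hd] <;> ring
    · have c1 : ¬ (2 ∣ e) := by lia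
      have c2 : ¬ (4 ∣ e) := by lia
      simp [w4, eta, odd1, c1, c2, he]; ring
  simp only [Finset.sum_add_distrib, ← Finset.mul_sum] at a4
  beta_reduce at a1 a2 a3
  rw [a2, a3, ← a1] at a4
  linarith

lemma F4_neg (n x y z : ℤ) : F4 n (-x) y z = - F4 n x y z := by
  simp only [F4, odd1_neg]; ring
lemma F4_neg2 (n x y z : ℤ) : F4 n x (-y) (-z) = F4 n x y z := by
  simp only [F4, eps_add_neg]; ring

lemma sum_odd2 (m : ℕ) :
    3 * ∑ j ∈ range (2 * m), odd1 j * (j : ℤ) ^ 2 = m * (4 * (m : ℤ) ^ 2 - 1) := by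
  induction m with
  | zero => simp
  | succ m ih =>
    rw [show 2 * (m + 1) = 2 * m + 1 + 1 by ring, Finset.sum_range_succ, Finset.sum_range_succ,
      mul_add, mul_add, ih]
    have h1 : odd1 (2 * (m : ℤ)) = 0 := by unfold odd1; split_ifs <;> lia
    have h2 : odd1 (2 * (m : ℤ) + 1) = 1 := by unfold odd1; split_ifs <;> lia
    push_cast
    rw [h1, h2]; ring

lemma sum_sq2 (m : ℕ) :
    6 * ∑ j ∈ range m, (j : ℤ) ^ 2 = m * (m - 1) * (2 * m - 1) := by
  induction m with
  | zero => simp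
  | succ m ih =>
    rw [Finset.sum_range_succ, mul_add, ih]
    push_cast; ring

lemma sum_eps2 (m : ℕ) :
    2 * ∑ j ∈ range m, eps j * (j : ℤ) ^ 2 = - eps m * (m * (m - 1)) := by
  induction m with
  | zero => simp
  | succ m ih =>
    rw [Finset.sum_range_succ, mul_add, ih]
    push_cast; rw [eps_succ]; ring

lemma four_squares (n : ℕ) (hn : 0 < n) :
    ((V 4 n).card : ℤ) = ∑ q ∈ DZ n, w4 q.1 q.2 := by
  refine main_step 4 w4 ?_ ?_ n hn
  · intro n hn hsq
    have h := liouville_nonsq n hsq (F4 n) (F4_neg n) (F4_neg2 n)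
    rw [F4_R] at h
    rw [F4_L]; lia
  · intro t ht
    have h := liouville_sq t ht (F4 ((t : ℤ) ^ 2)) (F4_neg _) (F4_neg2 _)
    rw [F4_R] at h
    rw [F4_L]
    have h1 : ∑ j ∈ range (2 * t), F4 ((t : ℤ) ^ 2) j t j
        = t * ∑ j ∈ range (2 * t), odd1 j * (j : ℤ) ^ 2 := by
      rw [Finset.mul_sum]
      refine Finset.sum_congr rfl fun j _ => ?_
      simp only [F4, eps_add, eps_sq, eps_mul_self]; ring
    have h2 : ∑ j ∈ range t, F4 ((t : ℤ) ^ 2) (2 * t) j (2 * j)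
        = 4 * t * ∑ j ∈ range t, (j : ℤ) ^ 2
          - 4 * t * eps t * ∑ j ∈ range t, eps j * (j : ℤ) ^ 2 := by
      rw [Finset.mul_sum, Finset.mul_sum, ← Finset.sum_sub_distrib]
      refine Finset.sum_congr rfl fun j _ => ?_
      have h1 : odd1 (2 * (t : ℤ)) = 0 := by unfold odd1; split_ifs <;> lia
      simp only [F4, eps_add, eps_sq, h1]; ring
    have h3 : F4 ((t : ℤ) ^ 2) (2 * t) 0 0 = 0 := by simp [F4]
    rw [h1, h2, h3] at h
    have := eps_mul_self t
    push_cast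
    have s1 := sum_odd2 t
    have s2 := sum_sq2 t
    have s3 := sum_eps2 t
    refine mul_left_cancel₀ (show (3 : ℤ) ≠ 0 by norm_num) ?_
    linear_combination 12 * h + (8 * t) * s1 - 16 * t * s2 + 48 * t * eps t * s3
      - 48 * (t : ℤ) ^ 2 * (t - 1) * this

/-! ### eight squares -/

def F8 (x y z : ℤ) : ℤ := if 2 ∣ x then
  32 * x ^ 3 * y ^ 2 + 96 * x * y ^ 2 * z ^ 2 - 2 * x ^ 3 * z ^ 2 + 3 * x * z ^ 4 - x ^ 5
    - 96 * x * y ^ 3 * z else 0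

def w8 (d e : ℤ) : ℤ := 16 * eta d e * d ^ 3

lemma F8_neg (x y z : ℤ) : F8 (-x) y z = - F8 x y z := by
  simp only [F8, dvd_neg]; split_ifs <;> ring
lemma F8_neg2 (x y z : ℤ) : F8 x (-y) (-z) = F8 x y z := by
  simp only [F8]; split_ifs <;> ring

/-- the auxiliary function antisymmetric in `d, h` -/
def G8 (i d h : ℤ) : ℤ :=
  2 * (F8 (2 * h - 2 * i) (d + i) (2 * d + 2 * i - 2 * h)
    + F8 (2 * h - 2 * -i) (d + -i) (2 * d + 2 * -i - 2 * h))
  - 64 * (8 * h ^ 3 - d ^ 3) * (2 * d * h - 8 * i ^ 2)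

lemma G8_anti (i d h : ℤ) : G8 i h d = - G8 i d h := by
  have c1 : ∀ a b : ℤ, (2 : ℤ) ∣ 2 * a - 2 * b := fun a b => ⟨a - b, by ring⟩
  simp only [G8, F8, c1, if_true]
  ring

def J8 (i d e : ℤ) : ℤ :=
  (if d % 2 = e % 2 then 32 else 0) * ((e ^ 3 - d ^ 3) * (d * e - 8 * i ^ 2))
  + 64 * ((if d % 2 = 0 ∧ e % 2 = 0 then 1 else 0) * (e ^ 3 - d ^ 3)
    + (if d % 2 = 1 ∧ e % 2 = 0 then 1 else 0) * e ^ 3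
    - (if e % 2 = 1 ∧ d % 2 = 0 then 1 else 0) * d ^ 3) * (d * e - 8 * i ^ 2)

lemma J8_anti (i d e : ℤ) : J8 i e d = - J8 i d e := by
  simp only [J8, eq_comm (a := e % 2) (b := d % 2), and_comm (a := e % 2 = 0) (b := d % 2 = 0)]
  ring

lemma F8_key (n : ℤ) : 4 * ∑ p ∈ S n, w8 p.2.1 p.2.2 * (p.2.1 * p.2.2 - (8 : ℕ) * p.1 ^ 2)
    = 4 * ∑ p ∈ S n, F8 (p.2.2 - 2 * p.1) (p.2.1 + p.1) (2 * p.2.1 + 2 * p.1 - p.2.2)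
      - 2 * ∑ p ∈ S n, F8 (p.2.1 + p.2.2) p.1 (p.2.1 - p.2.2) := by
  have a1 := sum_neg n (fun i d e => F8 (e - 2 * i) (d + i) (2 * d + 2 * i - e))
  have a2 := sum_neg n (fun i d e => F8 (d + e) i (d - e))
  have a3 := anti_dbl n G8 G8_anti
  have a4 := anti_swap n J8 J8_anti
  have a5 : ∑ p ∈ S n, (4 * (w8 p.2.1 p.2.2 * (p.2.1 * p.2.2 - (8 : ℕ) * p.1 ^ 2))
      + (if 2 ∣ p.2.2 then G8 p.1 p.2.1 (p.2.2 / 2) else 0) + J8 p.1 p.2.1 p.2.2)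
      = ∑ p ∈ S n, (2 * F8 (p.2.2 - 2 * p.1) (p.2.1 + p.1) (2 * p.2.1 + 2 * p.1 - p.2.2)
      + 2 * F8 (p.2.2 - 2 * -p.1) (p.2.1 + -p.1) (2 * p.2.1 + 2 * -p.1 - p.2.2)
      - (F8 (p.2.1 + p.2.2) p.1 (p.2.1 - p.2.2) + F8 (p.2.1 + p.2.2) (-p.1) (p.2.1 - p.2.2))) := by
    refine Finset.sum_congr rfl ?_
    rintro ⟨i, d, e⟩ hp
    clear hp a1 a2 a3 a4
    simp only
    rcases Int.emod_two_eq_zero_or_one e with he | he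
    · obtain ⟨h, rfl⟩ : (2 : ℤ) ∣ e := by lia
      have c1 : 2 * h / 2 = h := by lia
      have c0 : ∀ a b : ℤ, (2 : ℤ) ∣ 2 * a - 2 * b := fun a b => ⟨a - b, by ring⟩
      simp only [w8, eta, J8, G8, F8, c1, c0, he, dvd_mul_right, if_true]
      rcases Int.emod_two_eq_zero_or_one d with hd | hd
      · have c2 : (2 : ℤ) ∣ d + 2 * h := by lia
        simp [hd, c2]; ring
      · have c2 : ¬ (2 : ℤ) ∣ d + 2 * h := by lia
        simp [hd, c2]; ring
    · have c1 : ¬ (2 ∣ e) := by lia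
      have c2 : ∀ a, ¬ (2 ∣ e - 2 * a) := by intro a; lia
      simp only [w8, eta, J8, F8, c1, c2, he, if_false]
      rcases Int.emod_two_eq_zero_or_one d with hd | hd
      · have c3 : ¬ (2 : ℤ) ∣ d + e := by lia
        simp [hd, c3]; ring
      · have c3 : (2 : ℤ) ∣ d + e := by lia
        simp [hd, c3]; ring
  simp only [Finset.sum_add_distrib, Finset.sum_sub_distrib, ← Finset.mul_sum] at a5
  beta_reduce at a1 a2
  rw [a3, a4, ← a1, ← a2] at a5
  linarith

lemma sum_F8a (S : ℤ) (m : ℕ) : ∑ j ∈ range (2 * m), F8 j S j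
    = 32 * (8 * S ^ 2 * m ^ 2 * (m - 1) ^ 2 - 2 * S ^ 3 * (m * (m - 1) * (2 * m - 1))) := by
  induction m with
  | zero => simp
  | succ m ih =>
    rw [show 2 * (m + 1) = 2 * m + 1 + 1 by ring, Finset.sum_range_succ, Finset.sum_range_succ, ih]
    have h2 : ¬ (2 : ℤ) ∣ (2 * (m : ℤ) + 1) := by lia
    push_cast
    simp only [F8, h2, dvd_mul_right, if_true, if_false]; ring

lemma sum_F8b (S : ℤ) (m : ℕ) : 2 * ∑ j ∈ range m, F8 (2 * S) j (2 * j)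
    = 32 * (2 * S ^ 3 * (m * (m - 1) * (2 * m - 1))
      + S * (m * (m - 1) * (2 * m - 1) * (3 * m ^ 2 - 3 * m - 1)) - 2 * m * S ^ 5) := by
  induction m with
  | zero => simp
  | succ m ih =>
    rw [Finset.sum_range_succ, mul_add, ih]
    push_cast
    simp only [F8, dvd_mul_right, if_true]; ring

lemma eight_squares (n : ℕ) (hn : 0 < n) :
    ((V 8 n).card : ℤ) = ∑ q ∈ DZ n, w8 q.1 q.2 := by
  refine main_step 8 w8 ?_ ?_ n hn
  · intro n hn hsq
    have h := liouville_nonsq n hsq F8 F8_neg F8_neg2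
    have := F8_key n
    lia
  · intro t ht
    have h := liouville_sq t ht F8 F8_neg F8_neg2
    have h1 := F8_key ((t : ℤ) ^ 2)
    have h2 := sum_F8a t t
    have h3 := sum_F8b t t
    have h4 : F8 (2 * t) 0 0 = - 32 * (t : ℤ) ^ 5 := by
      simp only [F8, dvd_mul_right, if_true]; ring
    rw [h4, h2] at h
    refine mul_left_cancel₀ (show (4 : ℤ) ≠ 0 by norm_num) ?_
    rw [h1]
    push_cast
    linear_combination 2 * h - 2 * h3

/-! ### transfer to the frozen statement -/

lemma DZ_nat (n : ℕ) (g : ℤ → ℤ → ℤ) :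
    ∑ q ∈ DZ n, g q.1 q.2 = ∑ q ∈ n.divisorsAntidiagonal, g q.1 q.2 := by
  symm
  refine Finset.sum_nbij' (fun q => ((q.1 : ℤ), (q.2 : ℤ))) (fun q => (q.1.toNat, q.2.toNat))
    ?_ ?_ ?_ ?_ ?_
  · rintro ⟨d, e⟩ h
    rw [Nat.mem_divisorsAntidiagonal] at h
    rw [mem_DZ]
    simp only at h
    obtain ⟨rfl, h⟩ := h
    have h1 : d ≠ 0 := by rintro rfl; simp at h
    have h2 : e ≠ 0 := by rintro rfl; simp at h
    exact ⟨by lia, by lia, by push_cast; ring⟩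
  · rintro ⟨d, e⟩ h
    rw [mem_DZ] at h
    obtain ⟨h1, h2, h3⟩ := h
    rw [Nat.mem_divisorsAntidiagonal]
    simp only
    have : ((d.toNat * e.toNat : ℕ) : ℤ) = n := by
      push_cast; rw [Int.toNat_of_nonneg h1.le, Int.toNat_of_nonneg h2.le, h3]
    have h4 : 0 < d * e := mul_pos h1 h2
    exact ⟨by exact_mod_cast this, by lia⟩
  · rintro ⟨d, e⟩ h; simp
  · rintro ⟨d, e⟩ h
    rw [mem_DZ] at h
    obtain ⟨h1, h2, h3⟩ := h
    simp [h1.le, h2.le]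
  · rintro ⟨d, e⟩ h; rfl

/-- integral forms -/
lemma four_a (n : ℤ) : ∑ q ∈ DZ n, w4 q.1 q.2 = ∑ q ∈ DZ n, 8 * ((if q.1 % 4 = 0 then 0 else 1) * q.1) := by
  rw [DZ_swap n w4]
  refine Finset.sum_congr rfl fun q _ => ?_
  simp only [w4, Int.dvd_iff_emod_eq_zero]
  split_ifs <;> ring

lemma four_b (n : ℤ) : ∑ q ∈ DZ n, w4 q.1 q.2 = ∑ q ∈ DZ n, 8 * ((if q.2 % 4 = 0 then -3 else 1) * q.1) := by
  rw [DZ_swap n w4]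
  have h := DZ_dbl n 4 (by norm_num) (fun d _ => 32 * d)
  have h2 : ∑ q ∈ DZ n, (w4 q.2 q.1 + (if 4 ∣ q.1 then 32 * (q.1 / 4) else 0))
      = ∑ q ∈ DZ n, (8 * ((if q.2 % 4 = 0 then -3 else 1) * q.1)
        + (if 4 ∣ q.2 then 32 * q.1 else 0)) := by
    refine Finset.sum_congr rfl ?_
    rintro ⟨d, e⟩ _
    simp only [w4]
    split_ifs <;> lia
  rw [Finset.sum_add_distrib, Finset.sum_add_distrib] at h2
  lia

lemma eight_a (n : ℤ) : ∑ q ∈ DZ n, w8 q.1 q.2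
    = ∑ q ∈ DZ n, 4 * ((if q.1 % 4 = 2 then 3 else 4) * q.1 ^ 3) := by
  have h := DZ_dbl n 2 (by norm_num) (fun d _ => 32 * odd1 d * d ^ 3)
  have h2 : ∑ q ∈ DZ n, (w8 q.1 q.2 + (if 2 ∣ q.2 then 32 * odd1 q.1 * q.1 ^ 3 else 0))
      = ∑ q ∈ DZ n, (4 * ((if q.1 % 4 = 2 then 3 else 4) * q.1 ^ 3)
        + (if 2 ∣ q.1 then 32 * odd1 (q.1 / 2) * (q.1 / 2) ^ 3 else 0)) := by
    refine Finset.sum_congr rfl ?_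
    rintro ⟨d, e⟩ _
    simp only [w8, eta, odd1]
    rcases Int.emod_two_eq_zero_or_one d with hd | hd
    · obtain ⟨k, rfl⟩ : (2 : ℤ) ∣ d := by lia
      have c1 : 2 * k / 2 = k := by lia
      have c2 : (2 * k % 4 = 2) ↔ k % 2 = 1 := by lia
      rcases Int.emod_two_eq_zero_or_one k with hk | hk <;> simp [c1, c2, hk] <;> ring
    · have c1 : ¬ (2 ∣ d) := by lia
      have c2 : ¬ (d % 4 = 2) := by lia
      have c3 : 2 ∣ e ↔ e % 2 = 0 := by lia
      rcases Int.emod_two_eq_zero_or_one e with he | he <;> simp [c1, c2, c3, hd, he] <;> ring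
  rw [Finset.sum_add_distrib, Finset.sum_add_distrib] at h2
  lia

lemma eight_b (n : ℤ) : ∑ q ∈ DZ n, w8 q.1 q.2
    = ∑ q ∈ DZ n, 16 * ((if q.2 % 4 = 0 then 15 else if q.2 % 4 = 2 then -1 else 1) * q.1 ^ 3) := by
  have h := DZ_dbl n 2 (by norm_num) (fun d e => 256 * (1 - odd1 e) * d ^ 3)
  have h2 : ∑ q ∈ DZ n, (w8 q.1 q.2 + (if 2 ∣ q.2 then 256 * (1 - odd1 (q.2 / 2)) * q.1 ^ 3 else 0))
      = ∑ q ∈ DZ n,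
        (16 * ((if q.2 % 4 = 0 then 15 else if q.2 % 4 = 2 then -1 else 1) * q.1 ^ 3)
        + (if 2 ∣ q.1 then 256 * (1 - odd1 q.2) * (q.1 / 2) ^ 3 else 0)) := by
    refine Finset.sum_congr rfl ?_
    rintro ⟨d, e⟩ _
    simp only [w8, eta, odd1]
    rcases Int.emod_two_eq_zero_or_one e with he | he
    · obtain ⟨h, rfl⟩ : (2 : ℤ) ∣ e := by lia
      have c1 : 2 * h / 2 = h := by lia
      have c2 : (2 * h % 4 = 2) ↔ h % 2 = 1 := by lia
      have c3 : (2 * h % 4 = 0) ↔ h % 2 = 0 := by lia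
      rcases Int.emod_two_eq_zero_or_one d with hd | hd
      · obtain ⟨k, rfl⟩ : (2 : ℤ) ∣ d := by lia
        have c4 : 2 * k / 2 = k := by lia
        rcases Int.emod_two_eq_zero_or_one h with hh | hh <;> simp [c1, c2, c3, c4, hh] <;> ring
      · have c4 : ¬ (2 ∣ d) := by lia
        rcases Int.emod_two_eq_zero_or_one h with hh | hh <;>
          simp [c1, c2, c3, c4, hd, hh] <;> ring
    · have c1 : ¬ (2 ∣ e) := by lia
      have c2 : ¬ (e % 4 = 2) := by lia
      have c3 : ¬ (e % 4 = 0) := by lia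
      simp [c1, c2, c3, he]
  rw [Finset.sum_add_distrib, Finset.sum_add_distrib] at h2
  lia

end SSq

namespace SSq

lemma wdiv_eq (k N : ℕ) (χ : ℕ → ℂ) (ψ : ℤ → ℤ) (h : ∀ m : ℕ, χ (m % N) = (ψ m : ℂ)) (n : ℕ) :
    wdiv k N χ n = ((∑ q ∈ DZ n, ψ q.1 * q.1 ^ k : ℤ) : ℂ) := by
  rw [DZ_nat n (fun d _ => ψ d * d ^ k), wdiv]
  push_cast
  rw [Nat.sum_divisorsAntidiagonal (fun d _ => (ψ (d : ℤ) : ℂ) * (d : ℂ) ^ k)]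
  exact Finset.sum_congr rfl fun d _ => by rw [h]

lemma wdivc_eq (k N : ℕ) (χ : ℕ → ℂ) (ψ : ℤ → ℤ) (h : ∀ m : ℕ, χ (m % N) = (ψ m : ℂ)) (n : ℕ) :
    wdivc k N χ n = ((∑ q ∈ DZ n, ψ q.2 * q.1 ^ k : ℤ) : ℂ) := by
  rw [DZ_nat n (fun d e => ψ e * d ^ k), wdivc]
  push_cast
  rw [Nat.sum_divisorsAntidiagonal (fun d e => (ψ (e : ℤ) : ℂ) * (d : ℂ) ^ k)]
  exact Finset.sum_congr rfl fun d _ => by rw [h]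

lemma rep_cast (s n : ℕ) : (repSquares s n : ℂ) = (((V s n).card : ℤ) : ℂ) := by
  rw [repSquares_eq]; simp

lemma chi_cast (m : ℕ) : (fun m : ℕ => if m = 1 then (1 : ℂ) else if m = 3 then -1 else 0) (m % 4)
    = (chi m : ℂ) := by
  have h1 : ((m : ℤ) % 4 = 1) ↔ m % 4 = 1 := by lia
  have h3 : ((m : ℤ) % 4 = 3) ↔ m % 4 = 3 := by lia
  simp only [chi, h1, h3]
  split_ifs <;> simp

end SSq

open SSq
theorem sums_of_squares_formulas (n : ℕ) (hn : 1 ≤ n) :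
    ((repSquares 2 n : ℂ) =
        4 * wdiv 0 4 (fun m => if m = 1 then 1 else if m = 3 then -1 else 0) n) ∧
    ((repSquares 4 n : ℂ) =
        8 * wdiv 1 4 (fun m => if m = 0 then 0 else 1) n ∧
      (repSquares 4 n : ℂ) =
        8 * wdivc 1 4 (fun m => if m = 0 then -3 else 1) n) ∧
    ((repSquares 6 n : ℂ) =
        16 * wdivc 2 4 (fun m => if m = 1 then 1 else if m = 3 then -1 else 0) n -
          4 * wdiv 2 4 (fun m => if m = 1 then 1 else if m = 3 then -1 else 0) n) ∧
    ((repSquares 8 n : ℂ) =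
        4 * wdiv 3 4 (fun m => if m = 2 then 3 else 4) n ∧
      (repSquares 8 n : ℂ) =
        16 * wdivc 3 4 (fun m => if m = 0 then 15 else if m = 2 then -1 else 1) n) := by
  have m0 : ∀ m : ℕ, ((m : ℤ) % 4 = 0) ↔ m % 4 = 0 := by intro m; lia
  have m2 : ∀ m : ℕ, ((m : ℤ) % 4 = 2) ↔ m % 4 = 2 := by intro m; lia
  simp only [rep_cast]
  refine ⟨?_, ⟨?_, ?_⟩, ?_, ?_, ?_⟩
  · rw [two_squares n hn, wdiv_eq 0 4 _ chi chi_cast, DZ_swap n (fun d e => 4 * chi e),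
      ← Finset.mul_sum]
    simp
  · rw [four_squares n hn, four_a, wdiv_eq 1 4 _ (fun m => if m % 4 = 0 then 0 else 1)
      (fun m => by simp only [m0]; split_ifs <;> simp), ← Finset.mul_sum]
    simp
  · rw [four_squares n hn, four_b, wdivc_eq 1 4 _ (fun m => if m % 4 = 0 then -3 else 1)
      (fun m => by simp only [m0]; split_ifs <;> simp), ← Finset.mul_sum]
    simp
  · rw [six_squares n hn, wdiv_eq 2 4 _ chi chi_cast, wdivc_eq 2 4 _ chi chi_cast]
    have h := DZ_swap n (fun d e => chi d * d ^ 2)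
    beta_reduce at h
    rw [h]
    have h2 : ∑ q ∈ DZ n, 4 * chi q.2 * (4 * q.1 ^ 2 - q.2 ^ 2)
        = 16 * ∑ q ∈ DZ n, chi q.2 * q.1 ^ 2 - 4 * ∑ q ∈ DZ n, chi q.2 * q.2 ^ 2 := by
      rw [Finset.mul_sum, Finset.mul_sum, ← Finset.sum_sub_distrib]
      exact Finset.sum_congr rfl fun q _ => by ring
    rw [h2]
    push_cast; rfl
  · rw [eight_squares n hn, eight_a, wdiv_eq 3 4 _ (fun m => if m % 4 = 2 then 3 else 4)
      (fun m => by simp only [m2]; split_ifs <;> simp), ← Finset.mul_sum]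
    simp
  · rw [eight_squares n hn, eight_b, wdivc_eq 3 4 _
      (fun m => if m % 4 = 0 then 15 else if m % 4 = 2 then -1 else 1)
      (fun m => by simp only [m0, m2]; split_ifs <;> simp), ← Finset.mul_sum]
    simp
end
end

section
/- Let t_{2s}(n) denote the number of representations of a nonnegative integer n as an ordered sum of 2s triangular numbers m(m+1)/2 with m ranging over ℤ, i.e. the cardinality of {x ∈ ℤ^{2s} : x₁(x₁+1)/2 + ⋯ + x_{2s}(x_{2s}+1)/2 = n}. Then for all n ≥ 0: t₂(n) = 4·σ₀(8n+2; 0,1,0,−1); t₄(n) = 16·σ₁(2n+1), where σ₁(m) = ∑_{d∣m} d; t₆(n) = 8·σ₂(4n+3; 0,−1,0,1); and t₈(n) = 32·σ₃(n+1; 7,8) = 256·σᶜ₃(n+1; 0,1). -/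
open Complex

noncomputable section

/-- The number of representations of n as an ordered sum of s triangular numbers
m(m+1)/2, with m ranging over ℤ. -/
def repTriangles (s n : ℕ) : ℕ :=
  Nat.card {x : Fin s → ℤ // ∑ i, x i * (x i + 1) / 2 = (n : ℤ)}

/-! ### Bijection helpers for finsums -/

lemma tri_fs_bij {α β : Type} {s : Set α} {t : Set β} {f : α → ℤ} {g : β → ℤ}
    (e : α → β) (e' : β → α)
    (h1 : ∀ x ∈ s, e x ∈ t) (h2 : ∀ y ∈ t, e' y ∈ s)
    (h3 : ∀ x ∈ s, e' (e x) = x) (h4 : ∀ y ∈ t, e (e' y) = y)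
    (h5 : ∀ x ∈ s, f x = g (e x)) :
    ∑ᶠ i ∈ s, f i = ∑ᶠ j ∈ t, g j :=
  finsum_mem_eq_of_bijOn e (Set.InvOn.bijOn ⟨h3, h4⟩ h1 h2) h5

lemma tri_fin_bij {α β : Type} {s : Set α} {t : Set β}
    (e : α → β) (e' : β → α) (hs : s.Finite)
    (h2 : ∀ y ∈ t, e' y ∈ s) (h4 : ∀ y ∈ t, e (e' y) = y) : t.Finite :=
  (hs.image e).subset fun y hy => ⟨e' y, h2 y hy, h4 y hy⟩

/-! ### The Liouville-type identity -/

abbrev TriQ := ℤ × ℤ × ℤ × ℤ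

/-- Solutions of `a a' + b b' = N` in positive integers, `a`, `a'` odd. -/
def triT (N : ℤ) : Set TriQ :=
  {t | 0 < t.1 ∧ 0 < t.2.1 ∧ 0 < t.2.2.1 ∧ 0 < t.2.2.2 ∧ t.1 % 2 = 1 ∧ t.2.1 % 2 = 1 ∧
    t.1 * t.2.1 + t.2.2.1 * t.2.2.2 = N}

/-- Common conditions on `(y, E, e, d)`. -/
def triBase (N : ℤ) (t : TriQ) : Prop :=
  0 < t.1 ∧ 0 < t.2.1 ∧ t.2.2.2 % 2 = 1 ∧ (t.2.2.1 + t.1) % 2 = 1 ∧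
    t.2.2.1 * t.2.1 + t.1 * t.2.2.2 = N

def triA (N : ℤ) : Set TriQ :=
  {t | triBase N t ∧ ((0 < t.2.2.2 ∧ t.2.2.2 < t.2.1 ∧ 0 < t.2.2.1) ∨
    (-t.2.1 < t.2.2.2 ∧ t.2.2.2 < 0 ∧ t.1 < t.2.2.1))}

def triA0 (N : ℤ) : Set TriQ :=
  {t | triBase N t ∧ t.2.2.2 = -t.2.1 ∧ 2 * t.1 < t.2.2.1}

def triB (N : ℤ) : Set TriQ :=
  {t | triBase N t ∧ ((0 < t.2.2.1 ∧ t.2.2.1 < t.1 ∧ 0 < t.2.2.2) ∨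
    (-t.1 < t.2.2.1 ∧ t.2.2.1 < 0 ∧ t.2.1 < t.2.2.2))}

def triB0 (N : ℤ) : Set TriQ :=
  {t | triBase N t ∧ t.2.2.1 = 0 ∧ t.2.1 < t.2.2.2}

def triShift (t : TriQ) : TriQ :=
  (t.1, t.2.1, t.2.2.1 - 2 * (t.1 * ((t.2.2.1 + t.1) / (2 * t.1))),
    t.2.2.2 + 2 * (t.2.1 * ((t.2.2.1 + t.1) / (2 * t.1))))

def triUnshift (t : TriQ) : TriQ :=
  (t.1, t.2.1, t.2.2.1 + 2 * (t.1 * ((t.2.2.2 + t.2.1) / (2 * t.2.1))),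
    t.2.2.2 - 2 * (t.2.1 * ((t.2.2.2 + t.2.1) / (2 * t.2.1))))

lemma tri_div_spec (a y : ℤ) (hy : 0 < y) :
    2 * (y * ((a + y) / (2 * y))) ≤ a + y ∧ a + y < 2 * (y * ((a + y) / (2 * y))) + 2 * y := by
  have h1 := Int.mul_ediv_add_emod (a + y) (2 * y)
  have h2 := Int.emod_nonneg (a + y) (show 2 * y ≠ 0 by omega)
  have h3 := Int.emod_lt_of_pos (a + y) (show 0 < 2 * y by omega)
  rw [mul_assoc] at h1
  constructor <;> linarith

lemma tri_div_uniq (a y k : ℤ) (h1 : -y ≤ a) (h2 : a < y) :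
    (a + 2 * (y * k) + y) / (2 * y) = k := by
  have hy : 0 < 2 * y := by omega
  rw [show a + 2 * (y * k) + y = (a + y) + (2 * y) * k by ring,
    Int.add_mul_ediv_left _ _ hy.ne', Int.ediv_eq_zero_of_lt (by omega) (by omega), zero_add]

lemma tri_shift_mem {N : ℤ} (t : TriQ) (ht : t ∈ triA N ∪ triA0 N) :
    triShift t ∈ triB N ∪ triB0 N ∧ triUnshift (triShift t) = t := by
  obtain ⟨y, E, e, d⟩ := t
  have hb : triBase N (y, E, e, d) := by rcases ht with h | h <;> exact h.1
  have hc : (0 < d ∧ d < E ∧ 0 < e) ∨ (-E < d ∧ d < 0 ∧ y < e) ∨ (d = -E ∧ 2 * y < e) := by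
    rcases ht with h | h
    · rcases h.2 with h | h
      · exact Or.inl h
      · exact Or.inr (Or.inl h)
    · exact Or.inr (Or.inr h.2)
  obtain ⟨hy, hE, hd, hey, hN⟩ := hb
  simp only at hy hE hd hey hN
  have hs := tri_div_spec e y hy
  have hu := tri_div_uniq d E ((e + y) / (2 * y))
  simp only [triShift, triUnshift]
  generalize hk : (e + y) / (2 * y) = k at *
  have hu' : (d + 2 * (E * k) + E) / (2 * E) = k := by
    apply hu <;> omega
  refine ⟨?_, by rw [hu']; simp⟩
  have hN' : (e - 2 * (y * k)) * E + y * (d + 2 * (E * k)) = N := by rw [← hN]; ring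
  have hk0 : 0 ≤ k := by
    by_contra h
    have : y * k ≤ y * (-1) := mul_le_mul_of_nonneg_left (by omega) hy.le
    omega
  have hcase : k = 0 ∨ k = 1 ∨ 2 ≤ k := by omega
  have hb' : triBase N (y, E, e - 2 * (y * k), d + 2 * (E * k)) := by
    refine ⟨hy, hE, ?_, ?_, hN'⟩ <;> simp only <;> omega
  have key : (0 < e - 2 * (y * k) ∧ e - 2 * (y * k) < y ∧ 0 < d + 2 * (E * k)) ∨
      (-y < e - 2 * (y * k) ∧ e - 2 * (y * k) < 0 ∧ E < d + 2 * (E * k)) ∨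
      (e - 2 * (y * k) = 0 ∧ E < d + 2 * (E * k)) := by
    rcases hcase with h | h | h
    · subst h; simp only [mul_zero] at *; omega
    · subst h; simp only [mul_one] at *; omega
    · have h1 : E * 2 ≤ E * k := mul_le_mul_of_nonneg_left h hE.le
      have h2 : y * 2 ≤ y * k := mul_le_mul_of_nonneg_left h hy.le
      omega
  rcases key with h | h | h
  · exact Or.inl ⟨hb', Or.inl h⟩
  · exact Or.inl ⟨hb', Or.inr h⟩
  · exact Or.inr ⟨hb', h⟩

lemma tri_unshift_mem {N : ℤ} (t : TriQ) (ht : t ∈ triB N ∪ triB0 N) :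
    triUnshift t ∈ triA N ∪ triA0 N ∧ triShift (triUnshift t) = t := by
  obtain ⟨y, E, e, d⟩ := t
  have hb : triBase N (y, E, e, d) := by rcases ht with h | h <;> exact h.1
  have hc : (0 < e ∧ e < y ∧ 0 < d) ∨ (-y < e ∧ e < 0 ∧ E < d) ∨ (e = 0 ∧ E < d) := by
    rcases ht with h | h
    · rcases h.2 with h | h
      · exact Or.inl h
      · exact Or.inr (Or.inl h)
    · exact Or.inr (Or.inr h.2)
  obtain ⟨hy, hE, hd, hey, hN⟩ := hb
  simp only at hy hE hd hey hN
  have hs := tri_div_spec d E hE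
  have hu := tri_div_uniq e y ((d + E) / (2 * E))
  simp only [triShift, triUnshift]
  generalize hk : (d + E) / (2 * E) = k at *
  have hu' : (e + 2 * (y * k) + y) / (2 * y) = k := by
    apply hu <;> omega
  refine ⟨?_, by rw [hu']; simp⟩
  have hN' : (e + 2 * (y * k)) * E + y * (d - 2 * (E * k)) = N := by rw [← hN]; ring
  have hk0 : 0 ≤ k := by
    by_contra h
    have : E * k ≤ E * (-1) := mul_le_mul_of_nonneg_left (by omega) hE.le
    omega
  have hcase : k = 0 ∨ k = 1 ∨ 2 ≤ k := by omega
  have hb' : triBase N (y, E, e + 2 * (y * k), d - 2 * (E * k)) := by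
    refine ⟨hy, hE, ?_, ?_, hN'⟩ <;> simp only <;> omega
  have key : (0 < d - 2 * (E * k) ∧ d - 2 * (E * k) < E ∧ 0 < e + 2 * (y * k)) ∨
      (-E < d - 2 * (E * k) ∧ d - 2 * (E * k) < 0 ∧ y < e + 2 * (y * k)) ∨
      (d - 2 * (E * k) = -E ∧ 2 * y < e + 2 * (y * k)) := by
    rcases hcase with h | h | h
    · subst h; simp only [mul_zero] at *; omega
    · subst h; simp only [mul_one] at *; omega
    · have h1 : E * 2 ≤ E * k := mul_le_mul_of_nonneg_left h hE.le
      have h2 : y * 2 ≤ y * k := mul_le_mul_of_nonneg_left h hy.le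
      omega
  rcases key with h | h | h
  · exact Or.inl ⟨hb', Or.inl h⟩
  · exact Or.inl ⟨hb', Or.inr h⟩
  · exact Or.inr ⟨hb', h⟩

lemma tri_shift_sum (N : ℤ) (F : ℤ → ℤ) :
    ∑ᶠ t ∈ triA N ∪ triA0 N, F t.1 = ∑ᶠ t ∈ triB N ∪ triB0 N, F t.1 :=
  tri_fs_bij triShift triUnshift (fun t h => (tri_shift_mem t h).1)
    (fun t h => (tri_unshift_mem t h).1) (fun t h => (tri_shift_mem t h).2)
    (fun t h => (tri_unshift_mem t h).2) (fun _ _ => rfl)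

lemma triT_finite (N : ℤ) : (triT N).Finite := by
  have : ((Set.Icc (0 : ℤ) N) ×ˢ (Set.Icc (0 : ℤ) N) ×ˢ (Set.Icc (0 : ℤ) N) ×ˢ
      (Set.Icc (0 : ℤ) N)).Finite :=
    (Set.finite_Icc _ _).prod ((Set.finite_Icc _ _).prod ((Set.finite_Icc _ _).prod
      (Set.finite_Icc _ _)))
  refine this.subset ?_
  rintro ⟨a, a', b, b'⟩ ⟨h1, h2, h3, h4, -, -, h5⟩
  simp only at h1 h2 h3 h4 h5
  simp only [Set.mem_prod, Set.mem_Icc]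
  have := mul_pos h1 h2
  have := mul_pos h3 h4
  refine ⟨⟨?_, ?_⟩, ⟨?_, ?_⟩, ⟨?_, ?_⟩, ⟨?_, ?_⟩⟩ <;> nlinarith

def triTA (N : ℤ) : Set TriQ := {t | t ∈ triT N ∧ t.1 ≠ t.2.2.1}
def triTA0 (N : ℤ) : Set TriQ := {t | t ∈ triT N ∧ t.1 = t.2.2.1}
def triTB (N : ℤ) : Set TriQ := {t | t ∈ triT N ∧ t.2.1 ≠ t.2.2.2}
def triTB0 (N : ℤ) : Set TriQ := {t | t ∈ triT N ∧ t.2.1 = t.2.2.2}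

def triMapA (t : TriQ) : TriQ :=
  if t.2.2.1 < t.1 then (t.1 - t.2.2.1, t.2.1 + t.2.2.2, t.2.2.1, t.2.1)
  else (t.2.2.1 - t.1, t.2.1 + t.2.2.2, t.2.2.1, -t.2.1)

def triMapA' (t : TriQ) : TriQ :=
  if 0 < t.2.2.2 then (t.1 + t.2.2.1, t.2.2.2, t.2.2.1, t.2.1 - t.2.2.2)
  else (t.2.2.1 - t.1, -t.2.2.2, t.2.2.1, t.2.1 + t.2.2.2)

def triMapB (t : TriQ) : TriQ :=
  if t.2.1 < t.2.2.2 then (t.1 + t.2.2.1, t.2.2.2 - t.2.1, t.2.2.1, t.2.1)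
  else (t.1 + t.2.2.1, t.2.1 - t.2.2.2, -t.2.2.1, t.2.1)

def triMapB' (t : TriQ) : TriQ :=
  if 0 < t.2.2.1 then (t.1 - t.2.2.1, t.2.2.2, t.2.2.1, t.2.1 + t.2.2.2)
  else (t.1 + t.2.2.1, t.2.2.2, -t.2.2.1, t.2.2.2 - t.2.1)

lemma triMapA_mem {N : ℤ} (t : TriQ) (ht : t ∈ triTA N) :
    triMapA t ∈ triA N ∧ triMapA' (triMapA t) = t := by
  obtain ⟨a, a', b, b'⟩ := t
  obtain ⟨⟨h1, h2, h3, h4, h5, h6, h7⟩, h8⟩ := ht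
  simp only at h1 h2 h3 h4 h5 h6 h7 h8
  by_cases h : b < a
  · constructor
    · simp only [triMapA, h, if_true]
      refine ⟨⟨?_, ?_, ?_, ?_, ?_⟩, Or.inl ⟨?_, ?_, ?_⟩⟩ <;> simp only <;> first | omega | skip
      rw [← h7]; ring
    · simp [triMapA, triMapA', h, h2]
  · constructor
    · simp only [triMapA, h, if_false]
      refine ⟨⟨?_, ?_, ?_, ?_, ?_⟩, Or.inr ⟨?_, ?_, ?_⟩⟩ <;> simp only <;> first | omega | skip
      rw [← h7]; ring
    · have : ¬ (a' < 0) := by omega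
      simp [triMapA, triMapA', h, this]

lemma triMapA'_mem {N : ℤ} (t : TriQ) (ht : t ∈ triA N) :
    triMapA' t ∈ triTA N ∧ triMapA (triMapA' t) = t := by
  obtain ⟨y, E, e, d⟩ := t
  obtain ⟨⟨h1, h2, h3, h4, h5⟩, h6⟩ := ht
  simp only at h1 h2 h3 h4 h5 h6
  rcases h6 with h | h
  · have h0 := h.1
    constructor
    · simp only [triMapA', h0, if_true]
      refine ⟨⟨?_, ?_, ?_, ?_, ?_, ?_, ?_⟩, ?_⟩ <;> simp only <;> first | omega | skip
      rw [← h5]; ring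
    · simp [triMapA, triMapA', h0, h1]
  · have h0 : ¬ (0 < d) := by omega
    constructor
    · simp only [triMapA', h0, if_false]
      refine ⟨⟨?_, ?_, ?_, ?_, ?_, ?_, ?_⟩, ?_⟩ <;> simp only <;> first | omega | skip
      rw [← h5]; ring
    · have : ¬ (y < 0) := by omega
      simp [triMapA, triMapA', h0]
      intro hh; omega

lemma triMapB_mem {N : ℤ} (t : TriQ) (ht : t ∈ triTB N) :
    triMapB t ∈ triB N ∧ triMapB' (triMapB t) = t := by
  obtain ⟨a, a', b, b'⟩ := t
  obtain ⟨⟨h1, h2, h3, h4, h5, h6, h7⟩, h8⟩ := ht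
  simp only at h1 h2 h3 h4 h5 h6 h7 h8
  by_cases h : a' < b'
  · constructor
    · simp only [triMapB, h, if_true]
      refine ⟨⟨?_, ?_, ?_, ?_, ?_⟩, Or.inl ⟨?_, ?_, ?_⟩⟩ <;> simp only <;> first | omega | skip
      rw [← h7]; ring
    · simp [triMapB, triMapB', h, h3]
  · constructor
    · simp only [triMapB, h, if_false]
      refine ⟨⟨?_, ?_, ?_, ?_, ?_⟩, Or.inr ⟨?_, ?_, ?_⟩⟩ <;> simp only <;> first | omega | skip
      rw [← h7]; ring
    · have : ¬ (b < 0) := by omega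
      simp [triMapB, triMapB', h, this]

lemma triMapB'_mem {N : ℤ} (t : TriQ) (ht : t ∈ triB N) :
    triMapB' t ∈ triTB N ∧ triMapB (triMapB' t) = t := by
  obtain ⟨y, E, e, d⟩ := t
  obtain ⟨⟨h1, h2, h3, h4, h5⟩, h6⟩ := ht
  simp only at h1 h2 h3 h4 h5 h6
  rcases h6 with h | h
  · have h0 := h.1
    constructor
    · simp only [triMapB', h0, if_true]
      refine ⟨⟨?_, ?_, ?_, ?_, ?_, ?_, ?_⟩, ?_⟩ <;> simp only <;> first | omega | skip
      rw [← h5]; ring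
    · simp [triMapB, triMapB', h0, h2]
  · have h0 : ¬ (0 < e) := by omega
    constructor
    · simp only [triMapB', h0, if_false]
      refine ⟨⟨?_, ?_, ?_, ?_, ?_, ?_, ?_⟩, ?_⟩ <;> simp only <;> first | omega | skip
      rw [← h5]; ring
    · have : ¬ (E < 0) := by omega
      simp [triMapB, triMapB', h0]
      intro hh; omega

lemma triA_finite (N : ℤ) : (triA N).Finite :=
  tri_fin_bij triMapA triMapA' ((triT_finite N).subset fun _ h => h.1)
    (fun t h => (triMapA'_mem t h).1) (fun t h => (triMapA'_mem t h).2)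

lemma triB_finite (N : ℤ) : (triB N).Finite :=
  tri_fin_bij triMapB triMapB' ((triT_finite N).subset fun _ h => h.1)
    (fun t h => (triMapB'_mem t h).1) (fun t h => (triMapB'_mem t h).2)

lemma tri_sumA (N : ℤ) (F : ℤ → ℤ) (hF : ∀ x, F (-x) = F x) :
    ∑ᶠ t ∈ triT N, F (t.1 - t.2.2.1) = ∑ᶠ t ∈ triA N, F t.1 + ∑ᶠ t ∈ triTA0 N, F 0 := by
  have h1 : triT N = triTA N ∪ triTA0 N := by
    ext t; simp only [triTA, triTA0, Set.mem_union, Set.mem_ofPred_eq]; tauto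
  have h2 : Disjoint (triTA N) (triTA0 N) :=
    Set.disjoint_left.2 fun t h h' => h.2 h'.2
  rw [h1, finsum_mem_union h2 ((triT_finite N).subset fun _ h => h.1)
    ((triT_finite N).subset fun _ h => h.1)]
  congr 1
  · refine tri_fs_bij triMapA triMapA' (fun t h => (triMapA_mem t h).1)
      (fun t h => (triMapA'_mem t h).1) (fun t h => (triMapA_mem t h).2)
      (fun t h => (triMapA'_mem t h).2) ?_
    rintro ⟨a, a', b, b'⟩ h
    simp only [triMapA]
    split_ifs
    · rfl
    · simp only; rw [← hF]; congr 1; ring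
  · refine finsum_mem_congr rfl ?_
    rintro ⟨a, a', b, b'⟩ h
    have : a = b := h.2
    simp [this]

lemma tri_sumB (N : ℤ) (F : ℤ → ℤ) :
    ∑ᶠ t ∈ triT N, F (t.1 + t.2.2.1) =
      ∑ᶠ t ∈ triB N, F t.1 + ∑ᶠ t ∈ triTB0 N, F (t.1 + t.2.2.1) := by
  have h1 : triT N = triTB N ∪ triTB0 N := by
    ext t; simp only [triTB, triTB0, Set.mem_union, Set.mem_ofPred_eq]; tauto
  have h2 : Disjoint (triTB N) (triTB0 N) :=
    Set.disjoint_left.2 fun t h h' => h.2 h'.2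
  rw [h1, finsum_mem_union h2 ((triT_finite N).subset fun _ h => h.1)
    ((triT_finite N).subset fun _ h => h.1)]
  congr 1
  refine tri_fs_bij triMapB triMapB' (fun t h => (triMapB_mem t h).1)
      (fun t h => (triMapB'_mem t h).1) (fun t h => (triMapB_mem t h).2)
      (fun t h => (triMapB'_mem t h).2) ?_
  rintro ⟨a, a', b, b'⟩ h
  simp only [triMapB]
  split_ifs <;> rfl

lemma triA0_finite (N : ℤ) : (triA0 N).Finite := by
  have : ((Set.Icc (0 : ℤ) N) ×ˢ (Set.Icc (0 : ℤ) N) ×ˢ (Set.Icc (0 : ℤ) (2 * N)) ×ˢ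
      (Set.Icc (-N) 0)).Finite :=
    (Set.finite_Icc _ _).prod ((Set.finite_Icc _ _).prod ((Set.finite_Icc _ _).prod
      (Set.finite_Icc _ _)))
  refine this.subset ?_
  rintro ⟨y, E, e, d⟩ ⟨⟨h1, h2, -, -, h5⟩, h6, h7⟩
  simp only at h1 h2 h5 h6 h7
  subst h6
  have h8 : (e - y) * E = N := by rw [← h5]; ring
  have h9 : e - y ≤ N := by nlinarith
  have h10 : E ≤ N := by nlinarith
  simp only [Set.mem_prod, Set.mem_Icc]
  omega

lemma triB0_finite (N : ℤ) : (triB0 N).Finite := by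
  have : ((Set.Icc (0 : ℤ) N) ×ˢ (Set.Icc (0 : ℤ) N) ×ˢ (Set.Icc (0 : ℤ) 0) ×ˢ
      (Set.Icc 0 N)).Finite :=
    (Set.finite_Icc _ _).prod ((Set.finite_Icc _ _).prod ((Set.finite_Icc _ _).prod
      (Set.finite_Icc _ _)))
  refine this.subset ?_
  rintro ⟨y, E, e, d⟩ ⟨⟨h1, h2, -, -, h5⟩, h6, h7⟩
  simp only at h1 h2 h5 h6 h7
  subst h6
  have h8 : y * d = N := by rw [← h5]; ring
  have h9 : d ≤ N := by nlinarith
  have h10 : y ≤ N := by nlinarith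
  simp only [Set.mem_prod, Set.mem_Icc]
  omega

/-- The general Liouville-type identity. -/
lemma tri_liouville (N : ℤ) (F : ℤ → ℤ) (hF : ∀ x, F (-x) = F x) :
    ∑ᶠ t ∈ triT N, (F (t.1 - t.2.2.1) - F (t.1 + t.2.2.1)) =
      ∑ᶠ t ∈ triTA0 N, F 0 - ∑ᶠ t ∈ triTB0 N, F (t.1 + t.2.2.1)
        + ∑ᶠ t ∈ triB0 N, F t.1 - ∑ᶠ t ∈ triA0 N, F t.1 := by
  have h := tri_shift_sum N F
  have d1 : Disjoint (triA N) (triA0 N) := by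
    refine Set.disjoint_left.2 ?_
    rintro ⟨y, E, e, d⟩ ⟨h, h'⟩ ⟨-, h3⟩
    have := h.2.1
    simp only at h' h3 this; omega
  have d2 : Disjoint (triB N) (triB0 N) := by
    refine Set.disjoint_left.2 ?_
    rintro ⟨y, E, e, d⟩ ⟨h, h'⟩ ⟨-, h3⟩
    simp only at h' h3; omega
  rw [finsum_mem_union d1 (triA_finite N) (triA0_finite N),
    finsum_mem_union d2 (triB_finite N) (triB0_finite N)] at h
  rw [finsum_mem_sub_distrib _ _ (triT_finite N), tri_sumA N F hF, tri_sumB N F]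
  linarith

/-! ### Evaluating the sums -/

def triChi (x : ℤ) : ℤ := if x % 4 = 1 then 1 else if x % 4 = 3 then -1 else 0

def triE (m : ℕ) : ℤ := ∑ d ∈ m.divisors, triChi d

lemma tri_fs_finset {α β : Type} {s : Finset α} {t : Set β} {f : α → ℤ} {g : β → ℤ}
    (e : α → β) (e' : β → α)
    (h1 : ∀ x ∈ s, e x ∈ t) (h2 : ∀ y ∈ t, e' y ∈ s)
    (h3 : ∀ x ∈ s, e' (e x) = x) (h4 : ∀ y ∈ t, e (e' y) = y)
    (h5 : ∀ x ∈ s, f x = g (e x)) :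
    ∑ᶠ j ∈ t, g j = ∑ i ∈ s, f i := by
  rw [← finsum_mem_coe_finset]
  exact (tri_fs_bij e e' h1 h2 h3 h4 h5).symm

lemma triT_conv (N : ℕ) (f g : ℤ → ℤ) :
    ∑ᶠ t ∈ triT N, f t.1 * g t.2.2.1 =
      ∑ p ∈ (Finset.HasAntidiagonal.antidiagonal N).filter (fun p => p.1 % 2 = 1),
        (∑ a ∈ p.1.divisors, f a) * (∑ b ∈ p.2.divisors, g b) := by
  have : ∀ p ∈ (Finset.HasAntidiagonal.antidiagonal N).filter (fun p => p.1 % 2 = 1),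
      (∑ a ∈ p.1.divisors, f a) * (∑ b ∈ p.2.divisors, g b) =
      ∑ x ∈ p.1.divisors ×ˢ p.2.divisors, f x.1 * g x.2 := by
    intro p _
    rw [Finset.sum_mul_sum, Finset.sum_product]
  rw [Finset.sum_congr rfl this, Finset.sum_sigma']
  refine tri_fs_finset
    (fun x => ((x.2.1 : ℤ), ((x.1.1 / x.2.1 : ℕ) : ℤ), (x.2.2 : ℤ), ((x.1.2 / x.2.2 : ℕ) : ℤ)))
    (fun t => ⟨(t.1.toNat * t.2.1.toNat, t.2.2.1.toNat * t.2.2.2.toNat),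
      (t.1.toNat, t.2.2.1.toNat)⟩) ?_ ?_ ?_ ?_ ?_
  · rintro ⟨⟨m, m'⟩, a, b⟩ h
    simp only [Finset.mem_sigma, Finset.mem_filter, Finset.HasAntidiagonal.mem_antidiagonal, Finset.mem_product,
      Nat.mem_divisors] at h
    obtain ⟨⟨h1, h2⟩, ⟨⟨a', rfl⟩, h3⟩, ⟨b', rfl⟩, h4⟩ := h
    have ha : 0 < a := Nat.pos_of_ne_zero fun h => h3 (by simp [h])
    have ha' : 0 < a' := Nat.pos_of_ne_zero fun h => h3 (by simp [h])
    have hb : 0 < b := Nat.pos_of_ne_zero fun h => h4 (by simp [h])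
    have hb' : 0 < b' := Nat.pos_of_ne_zero fun h => h4 (by simp [h])
    have hodd : Odd (a * a') := Nat.odd_iff.2 h2
    rw [Nat.odd_mul, Nat.odd_iff, Nat.odd_iff] at hodd
    simp only [Nat.mul_div_cancel_left _ ha, Nat.mul_div_cancel_left _ hb]
    refine ⟨?_, ?_, ?_, ?_, ?_, ?_, ?_⟩ <;> simp only <;> first | omega | skip
  · rintro ⟨a, a', b, b'⟩ ⟨h1, h2, h3, h4, h5, h6, h7⟩
    simp only at h1 h2 h3 h4 h5 h6 h7
    lift a to ℕ using h1.le
    lift a' to ℕ using h2.le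
    lift b to ℕ using h3.le
    lift b' to ℕ using h4.le
    have hodd : Odd (a * a') := Nat.odd_mul.2 ⟨Nat.odd_iff.2 (by omega), Nat.odd_iff.2 (by omega)⟩
    simp only [Finset.mem_sigma, Finset.mem_filter, Finset.HasAntidiagonal.mem_antidiagonal, Finset.mem_product,
      Nat.mem_divisors, Int.toNat_natCast]
    refine ⟨⟨by exact_mod_cast h7, Nat.odd_iff.1 hodd⟩, ⟨Dvd.intro _ rfl, ?_⟩, Dvd.intro _ rfl, ?_⟩
    · exact Nat.mul_ne_zero (by omega) (by omega)
    · exact Nat.mul_ne_zero (by omega) (by omega)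
  · rintro ⟨⟨m, m'⟩, a, b⟩ h
    simp only [Finset.mem_sigma, Finset.mem_filter, Finset.HasAntidiagonal.mem_antidiagonal, Finset.mem_product,
      Nat.mem_divisors] at h
    obtain ⟨-, ⟨h1, -⟩, h2, -⟩ := h
    simp only [Int.toNat_natCast, Nat.mul_div_cancel' h1, Nat.mul_div_cancel' h2]
  · rintro ⟨a, a', b, b'⟩ ⟨h1, h2, h3, h4, h5, h6, h7⟩
    simp only at h1 h2 h3 h4 h5 h6 h7
    lift a to ℕ using h1.le
    lift a' to ℕ using h2.le
    lift b to ℕ using h3.le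
    lift b' to ℕ using h4.le
    simp only [Int.toNat_natCast]
    rw [Nat.mul_div_cancel_left _ (by omega), Nat.mul_div_cancel_left _ (by omega)]
  · intro x _
    rfl

lemma tri_card_odd (c : ℕ) : ((Finset.range c).filter (fun a => a % 2 = 1)).card = c / 2 := by
  induction c with
  | zero => rfl
  | succ c ih =>
    rw [Finset.range_add_one, Finset.filter_insert]
    split_ifs with h
    · rw [Finset.card_insert_of_notMem (by simp), ih]; omega
    · rw [ih]; omega

lemma triTB0_sum (N : ℕ) (hN : 0 < N) (G : ℤ → ℤ) :
    ∑ᶠ t ∈ triTB0 N, G (t.1 + t.2.2.1) =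
      ∑ c ∈ N.divisors.filter (fun c => (N / c) % 2 = 1), ((c / 2 : ℕ) : ℤ) * G c := by
  have : ∀ c ∈ N.divisors.filter (fun c => (N / c) % 2 = 1), ((c / 2 : ℕ) : ℤ) * G c =
      ∑ a ∈ (Finset.range c).filter (fun a => a % 2 = 1), G c := by
    intro c _
    rw [Finset.sum_const, tri_card_odd, nsmul_eq_mul]
  rw [Finset.sum_congr rfl this, Finset.sum_sigma']
  refine tri_fs_finset
    (fun x => ((x.2 : ℤ), ((N / x.1 : ℕ) : ℤ), (x.1 : ℤ) - (x.2 : ℤ), ((N / x.1 : ℕ) : ℤ)))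
    (fun t => ⟨(t.1 + t.2.2.1).toNat, t.1.toNat⟩) ?_ ?_ ?_ ?_ ?_
  · rintro ⟨c, a⟩ h
    simp only [Finset.mem_sigma, Finset.mem_filter, Finset.mem_range,
      Nat.mem_divisors] at h
    obtain ⟨⟨⟨⟨c', rfl⟩, h3⟩, h4⟩, h5, h6⟩ := h
    have hc : 0 < c := by omega
    rw [Nat.mul_div_cancel_left _ hc] at h4
    simp only [Nat.mul_div_cancel_left _ hc]
    refine ⟨⟨?_, ?_, ?_, ?_, ?_, ?_, ?_⟩, rfl⟩ <;> simp only <;> first | omega | skip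
    push_cast; ring
  · rintro ⟨a, a', b, b'⟩ ⟨⟨h1, h2, h3, h4, h5, h6, h7⟩, h8⟩
    simp only at h1 h2 h3 h4 h5 h6 h7 h8
    subst h8
    lift a to ℕ using h1.le
    lift a' to ℕ using h2.le
    lift b to ℕ using h3.le
    have h7' : N = (a + b) * a' := by zify; rw [← h7]; ring
    have : ((a : ℤ) + (b : ℤ)).toNat = a + b := by omega
    simp only [Finset.mem_sigma, Finset.mem_filter, Finset.mem_range,
      Nat.mem_divisors, Int.toNat_natCast, this]
    refine ⟨⟨⟨⟨a', h7'⟩, hN.ne'⟩, ?_⟩, by omega, by omega⟩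
    rw [h7', Nat.mul_div_cancel_left _ (by omega)]
    omega
  · rintro ⟨c, a⟩ h
    simp
  · rintro ⟨a, a', b, b'⟩ ⟨⟨h1, h2, h3, h4, h5, h6, h7⟩, h8⟩
    simp only at h1 h2 h3 h4 h5 h6 h7 h8
    subst h8
    lift a to ℕ using h1.le
    lift a' to ℕ using h2.le
    lift b to ℕ using h3.le
    have h7' : N = (a + b) * a' := by zify; rw [← h7]; ring
    have : ((a : ℤ) + (b : ℤ)).toNat = a + b := by omega
    simp only [Int.toNat_natCast, this]
    rw [h7', Nat.mul_div_cancel_left _ (by omega)]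
    simp
  · rintro ⟨c, a⟩ h
    simp

lemma triTA0_sum (N : ℕ) (hN : 0 < N) (k : ℤ) :
    ∑ᶠ t ∈ triTA0 N, k =
      ∑ c ∈ N.divisors.filter (fun c => (N / c) % 2 = 1), ((c / 2 : ℕ) : ℤ) * k := by
  rw [← triTB0_sum N hN (fun _ => k)]
  refine tri_fs_bij (fun t => (t.2.1, t.1, t.2.2.2, t.2.2.1)) (fun t => (t.2.1, t.1, t.2.2.2, t.2.2.1))
    ?_ ?_ (fun _ _ => rfl) (fun _ _ => rfl) (fun _ _ => rfl)
  · rintro ⟨a, a', b, b'⟩ ⟨⟨h1, h2, h3, h4, h5, h6, h7⟩, h8⟩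
    exact ⟨⟨h2, h1, h4, h3, h6, h5, by rw [← h7]; ring⟩, h8⟩
  · rintro ⟨a, a', b, b'⟩ ⟨⟨h1, h2, h3, h4, h5, h6, h7⟩, h8⟩
    exact ⟨⟨h2, h1, h4, h3, h6, h5, by rw [← h7]; ring⟩, h8⟩

lemma tri_emod_mul (a b : ℤ) (h : (a * b) % 2 = 1) : a % 2 = 1 ∧ b % 2 = 1 := by
  have := Int.odd_mul.1 (Int.odd_iff.2 h)
  exact ⟨Int.odd_iff.1 this.1, Int.odd_iff.1 this.2⟩

lemma tri_mul_emod (a b : ℤ) (ha : a % 2 = 1) (hb : b % 2 = 1) : (a * b) % 2 = 1 :=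
  Int.odd_iff.1 (Int.odd_mul.2 ⟨Int.odd_iff.2 ha, Int.odd_iff.2 hb⟩)

lemma triB0_even (N : ℤ) (hN : N % 2 = 0) : triB0 N = ∅ := by
  ext ⟨y, E, e, d⟩
  refine iff_of_false ?_ (Set.notMem_empty _)
  rintro ⟨⟨h1, h2, h3, h4, h5⟩, h6, h7⟩
  simp only at h1 h2 h3 h4 h5 h6 h7
  subst h6
  have := tri_mul_emod y d (by omega) h3
  rw [zero_mul] at h5
  omega

lemma triA0_even (N : ℤ) (hN : N % 2 = 0) : triA0 N = ∅ := by
  ext ⟨y, E, e, d⟩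
  refine iff_of_false ?_ (Set.notMem_empty _)
  rintro ⟨⟨h1, h2, h3, h4, h5⟩, h6, h7⟩
  simp only at h1 h2 h3 h4 h5 h6 h7
  subst h6
  have := tri_mul_emod (e - y) E (by omega) (by omega)
  rw [show (e - y) * E = e * E + y * (-E) by ring] at this
  omega

lemma triB0_sum (N : ℕ) (hN : N % 2 = 1) (G : ℤ → ℤ) :
    ∑ᶠ t ∈ triB0 N, G t.1 =
      ∑ y ∈ N.divisors, (((N / y : ℕ) : ℤ) - 1) * G y := by
  have : ∀ y ∈ N.divisors, (((N / y : ℕ) : ℤ) - 1) * G y =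
      ∑ a ∈ Finset.Ico 1 (N / y), G y := by
    intro c hc
    rw [Finset.sum_const, Nat.card_Ico, nsmul_eq_mul]
    have : 0 < N / c := Nat.div_pos (Nat.divisor_le hc) (Nat.pos_of_mem_divisors hc)
    push_cast [this]; rfl
  rw [Finset.sum_congr rfl this, Finset.sum_sigma']
  refine tri_fs_finset
    (fun x => ((x.1 : ℤ), (x.2 : ℤ), 0, ((N / x.1 : ℕ) : ℤ)))
    (fun t => ⟨t.1.toNat, t.2.1.toNat⟩) ?_ ?_ ?_ ?_ ?_
  · rintro ⟨c, a⟩ h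
    simp only [Finset.mem_sigma, Finset.mem_Ico, Nat.mem_divisors] at h
    obtain ⟨⟨⟨c', rfl⟩, h3⟩, h4, h5⟩ := h
    have hc : 0 < c := Nat.pos_of_ne_zero fun h => h3 (by simp [h])
    rw [Nat.mul_div_cancel_left _ hc] at h5
    simp only [Nat.mul_div_cancel_left _ hc]
    have h6 := tri_emod_mul c c' (by exact_mod_cast hN)
    refine ⟨⟨?_, ?_, ?_, ?_, ?_⟩, rfl, ?_⟩ <;> simp only <;> first | omega | skip
  · rintro ⟨y, E, e, d⟩ ⟨⟨h1, h2, h3, h4, h5⟩, h6, h7⟩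
    simp only at h1 h2 h3 h4 h5 h6 h7
    subst h6
    lift y to ℕ using h1.le
    lift E to ℕ using h2.le
    lift d to ℕ using (h2.trans h7).le
    have h7' : N = y * d := by zify; rw [← h5]; ring
    simp only [Finset.mem_sigma, Finset.mem_Ico, Nat.mem_divisors, Int.toNat_natCast]
    refine ⟨⟨⟨d, h7'⟩, by omega⟩, by omega, ?_⟩
    rw [h7', Nat.mul_div_cancel_left _ (by omega)]
    omega
  · rintro ⟨c, a⟩ h
    simp
  · rintro ⟨y, E, e, d⟩ ⟨⟨h1, h2, h3, h4, h5⟩, h6, h7⟩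
    simp only at h1 h2 h3 h4 h5 h6 h7
    subst h6
    lift y to ℕ using h1.le
    lift E to ℕ using h2.le
    lift d to ℕ using (h2.trans h7).le
    have h7' : N = y * d := by zify; rw [← h5]; ring
    simp only [Int.toNat_natCast]
    rw [h7', Nat.mul_div_cancel_left _ (by omega)]
  · rintro ⟨c, a⟩ h
    simp

lemma triA0_sum (N : ℕ) (hN : N % 2 = 1) (G : ℤ → ℤ) :
    ∑ᶠ t ∈ triA0 N, G t.1 =
      ∑ M ∈ N.divisors, ∑ y ∈ Finset.Ico 1 M, G y := by
  rw [Finset.sum_sigma']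
  refine tri_fs_finset
    (fun x => ((x.2 : ℤ), ((N / x.1 : ℕ) : ℤ), (x.1 : ℤ) + (x.2 : ℤ), -((N / x.1 : ℕ) : ℤ)))
    (fun t => ⟨(t.2.2.1 - t.1).toNat, t.1.toNat⟩) ?_ ?_ ?_ ?_ ?_
  · rintro ⟨c, a⟩ h
    simp only [Finset.mem_sigma, Finset.mem_Ico, Nat.mem_divisors] at h
    obtain ⟨⟨⟨c', rfl⟩, h3⟩, h4, h5⟩ := h
    have hc : 0 < c := Nat.pos_of_ne_zero fun h => h3 (by simp [h])
    have hc' : 0 < c' := Nat.pos_of_ne_zero fun h => h3 (by simp [h])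
    simp only [Nat.mul_div_cancel_left _ hc]
    have h6 := tri_emod_mul c c' (by exact_mod_cast hN)
    refine ⟨⟨?_, ?_, ?_, ?_, ?_⟩, rfl, ?_⟩ <;> simp only <;> first | omega | skip
    push_cast; ring
  · rintro ⟨y, E, e, d⟩ ⟨⟨h1, h2, h3, h4, h5⟩, h6, h7⟩
    simp only at h1 h2 h3 h4 h5 h6 h7
    subst h6
    lift y to ℕ using h1.le
    lift E to ℕ using h2.le
    obtain ⟨f, rfl⟩ : ∃ f : ℕ, e = y + f := ⟨(e - y).toNat, by omega⟩
    have h7' : N = f * E := by zify; rw [← h5]; ring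
    have : ((y : ℤ) + (f : ℤ) - y).toNat = f := by omega
    simp only [Finset.mem_sigma, Finset.mem_Ico, Nat.mem_divisors, Int.toNat_natCast, this]
    exact ⟨⟨⟨E, h7'⟩, by omega⟩, by omega, by omega⟩
  · rintro ⟨c, a⟩ h
    simp
  · rintro ⟨y, E, e, d⟩ ⟨⟨h1, h2, h3, h4, h5⟩, h6, h7⟩
    simp only at h1 h2 h3 h4 h5 h6 h7
    subst h6
    lift y to ℕ using h1.le
    lift E to ℕ using h2.le
    obtain ⟨f, rfl⟩ : ∃ f : ℕ, e = y + f := ⟨(e - y).toNat, by omega⟩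
    have h7' : N = f * E := by zify; rw [← h5]; ring
    have : ((y : ℤ) + (f : ℤ) - y).toNat = f := by omega
    simp only [Int.toNat_natCast, this]
    rw [h7', Nat.mul_div_cancel_left _ (by omega), add_comm (f : ℤ)]
  · rintro ⟨c, a⟩ h
    simp

/-! ### The three convolution identities -/

lemma triChi_neg (x : ℤ) : triChi (-x) = -triChi x := by
  unfold triChi; split_ifs <;> omega

lemma triE_three (m : ℕ) (hm : m % 4 = 3) : triE m = 0 := by
  have h1 : ∑ d ∈ m.divisors, triChi ((m / d : ℕ) : ℤ) = triE m :=
    Nat.sum_div_divisors m (fun d => triChi (d : ℤ))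
  have h2 : ∑ d ∈ m.divisors, triChi ((m / d : ℕ) : ℤ) = -triE m := by
    rw [triE, ← Finset.sum_neg_distrib]
    refine Finset.sum_congr rfl ?_
    intro d hd
    obtain ⟨e, rfl⟩ := Nat.dvd_of_mem_divisors hd
    rw [Nat.mul_div_cancel_left _ (Nat.pos_of_mem_divisors hd)]
    rw [Nat.mul_mod] at hm
    have h1 : d % 4 < 4 := Nat.mod_lt _ (by norm_num)
    have h2 : e % 4 < 4 := Nat.mod_lt _ (by norm_num)
    have : (d % 4 = 1 ∧ e % 4 = 3) ∨ (d % 4 = 3 ∧ e % 4 = 1) := by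
      generalize d % 4 = x at *
      generalize e % 4 = y at *
      interval_cases x <;> interval_cases y <;> omega
    unfold triChi
    split_ifs <;> omega
  omega

def triS (m : ℕ) : ℤ := ∑ d ∈ m.divisors, (d : ℤ)

lemma tri_div_two (M : ℕ) (h : ℕ → ℤ) :
    ∑ c ∈ (2 * M).divisors.filter (fun c => (2 * M / c) % 2 = 1), h c =
      ∑ c ∈ M.divisors.filter (fun c => (M / c) % 2 = 1), h (2 * c) := by
  symm
  refine Finset.sum_nbij' (fun c => 2 * c) (fun c => c / 2) ?_ ?_ ?_ ?_ ?_
  · intro c hc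
    simp only [Finset.mem_filter, Nat.mem_divisors] at hc ⊢
    refine ⟨⟨mul_dvd_mul_left 2 hc.1.1, by omega⟩, ?_⟩
    rw [Nat.mul_div_mul_left _ _ (by norm_num)]
    exact hc.2
  · intro c hc
    simp only [Finset.mem_filter, Nat.mem_divisors] at hc ⊢
    obtain ⟨⟨⟨e, he⟩, h0⟩, h1⟩ := hc
    have hcpos : 0 < c := Nat.pos_of_ne_zero fun h => h0 (by simp [he, h])
    rw [he, Nat.mul_div_cancel_left _ hcpos] at h1
    have hc2 : c % 2 = 0 := by
      have : Even (c * e) := ⟨M, by omega⟩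
      rw [Nat.even_mul] at this
      rcases this with h | h
      · exact Nat.even_iff.1 h
      · have := Nat.even_iff.1 h; omega
    obtain ⟨k, rfl⟩ : ∃ k, c = 2 * k := ⟨c / 2, by omega⟩
    have hM : M = k * e := by rw [mul_assoc] at he; omega
    rw [Nat.mul_div_cancel_left _ (by norm_num)]
    refine ⟨⟨⟨e, hM⟩, by omega⟩, ?_⟩
    rw [hM, Nat.mul_div_cancel_left _ (by omega)]; exact h1
  · intro c _
    simp
  · intro c hc
    simp only [Finset.mem_filter, Nat.mem_divisors] at hc
    obtain ⟨⟨⟨e, he⟩, h0⟩, h1⟩ := hc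
    have hcpos : 0 < c := Nat.pos_of_ne_zero fun h => h0 (by simp [he, h])
    rw [he, Nat.mul_div_cancel_left _ hcpos] at h1
    have : Even (c * e) := ⟨M, by omega⟩
    rw [Nat.even_mul, Nat.even_iff, Nat.even_iff] at this
    show 2 * (c / 2) = c
    omega
  · intro c _
    rfl

lemma tri_liouville_even (M : ℕ) (hM : 0 < M) (F : ℤ → ℤ) (hF : ∀ x, F (-x) = F x) :
    ∑ᶠ t ∈ triT (2 * M : ℕ), (F (t.1 - t.2.2.1) - F (t.1 + t.2.2.1)) =
      ∑ c ∈ M.divisors.filter (fun c => (M / c) % 2 = 1), (c : ℤ) * (F 0 - F (2 * c)) := by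
  rw [tri_liouville _ F hF, triA0_even _ (by omega), triB0_even _ (by omega),
    triTA0_sum _ (by omega), triTB0_sum _ (by omega), tri_div_two, tri_div_two]
  simp only [finsum_mem_empty, add_zero, sub_zero]
  rw [← Finset.sum_sub_distrib]
  refine Finset.sum_congr rfl fun c _ => ?_
  rw [Nat.mul_div_cancel_left _ (by norm_num)]
  push_cast; ring

lemma tri_conv8 (n : ℕ) :
    ∑ p ∈ Finset.HasAntidiagonal.antidiagonal n, triS (2 * p.1 + 1) * triS (2 * p.2 + 1) =
      ∑ c ∈ (n + 1).divisors.filter (fun c => ((n + 1) / c) % 2 = 1), (c : ℤ) ^ 3 := by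
  have h1 := tri_liouville_even (n + 1) (by omega) (fun x => x ^ 2) (fun x => by ring)
  have h2 := triT_conv (2 * (n + 1)) (fun x => -4 * x) (fun x => x)
  have h3 : ∑ᶠ t ∈ triT (2 * (n + 1) : ℕ), (-4 * t.1) * t.2.2.1 =
      ∑ᶠ t ∈ triT (2 * (n + 1) : ℕ), ((t.1 - t.2.2.1) ^ 2 - (t.1 + t.2.2.1) ^ 2) :=
    finsum_mem_congr rfl fun t _ => by ring
  beta_reduce at h1 h2
  rw [h3, h1] at h2
  have h4 : ∑ p ∈ Finset.HasAntidiagonal.antidiagonal n, triS (2 * p.1 + 1) * triS (2 * p.2 + 1) =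
      ∑ p ∈ (Finset.HasAntidiagonal.antidiagonal (2 * (n + 1))).filter (fun p => p.1 % 2 = 1),
        triS p.1 * triS p.2 := by
    refine Finset.sum_of_injOn (fun p => (2 * p.1 + 1, 2 * p.2 + 1)) ?_ ?_ ?_ ?_
    · rintro ⟨a, b⟩ - ⟨c, d⟩ - h
      simp only [Prod.mk.injEq] at h ⊢; omega
    · rintro ⟨a, b⟩ h
      simp only [Finset.coe_filter, Finset.mem_coe, Finset.HasAntidiagonal.mem_antidiagonal, Set.mem_ofPred_eq] at h ⊢
      omega
    · rintro ⟨a, b⟩ h h'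
      exfalso; apply h'
      simp only [Finset.mem_filter, Finset.HasAntidiagonal.mem_antidiagonal] at h
      refine ⟨(a / 2, b / 2), ?_, ?_⟩
      · simp only [Finset.mem_coe, Finset.HasAntidiagonal.mem_antidiagonal]; omega
      · simp only [Prod.mk.injEq]; omega
    · intro p _; rfl
  have h5 : ∑ p ∈ (Finset.HasAntidiagonal.antidiagonal (2 * (n + 1))).filter (fun p => p.1 % 2 = 1),
        (∑ a ∈ p.1.divisors, -4 * (a : ℤ)) * (∑ b ∈ p.2.divisors, (b : ℤ)) = 
        -4 * ∑ p ∈ (Finset.HasAntidiagonal.antidiagonal (2 * (n + 1))).filter (fun p => p.1 % 2 = 1),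
        triS p.1 * triS p.2 := by
    rw [Finset.mul_sum]
    refine Finset.sum_congr rfl fun p _ => ?_
    rw [← Finset.mul_sum, triS, triS, mul_assoc]
  rw [h5, ← h4] at h2
  have h6 : ∑ c ∈ (n + 1).divisors.filter (fun c => ((n + 1) / c) % 2 = 1),
      (c : ℤ) * (0 ^ 2 - (2 * (c : ℤ)) ^ 2) =
      -4 * ∑ c ∈ (n + 1).divisors.filter (fun c => ((n + 1) / c) % 2 = 1), (c : ℤ) ^ 3 := by
    rw [Finset.mul_sum]
    exact Finset.sum_congr rfl fun c _ => by ring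
  rw [h6] at h2
  omega

def triF4 (x : ℤ) : ℤ := if x % 4 = 0 then 1 else if x % 4 = 2 then -1 else 0

lemma triF4_sub (a b : ℤ) (ha : a % 2 = 1) :
    triF4 (a - b) - triF4 (a + b) = (2 * triChi a) * triChi b := by
  have h : (a % 4 = 1 ∨ a % 4 = 3) := by omega
  have h' : (b % 4 = 0 ∨ b % 4 = 1 ∨ b % 4 = 2 ∨ b % 4 = 3) := by omega
  have e1 : (a - b) % 4 = (a % 4 - b % 4) % 4 := by omega
  have e2 : (a + b) % 4 = (a % 4 + b % 4) % 4 := by omega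
  unfold triF4 triChi
  rw [e1, e2]
  rcases h with h | h <;> rcases h' with h' | h' | h' | h' <;> rw [h, h'] <;> norm_num

lemma tri_conv4 (n : ℕ) :
    ∑ p ∈ Finset.HasAntidiagonal.antidiagonal n, triE (4 * p.1 + 1) * triE (4 * p.2 + 1) =
      triS (2 * n + 1) := by
  have h1 := tri_liouville_even (2 * n + 1) (by omega) triF4 (fun x => by
    unfold triF4; split_ifs <;> omega)
  have h2 := triT_conv (2 * (2 * n + 1)) (fun x => 2 * triChi x) (fun x => triChi x)
  have h3 : ∑ᶠ t ∈ triT (2 * (2 * n + 1) : ℕ), (2 * triChi t.1) * triChi t.2.2.1 =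
      ∑ᶠ t ∈ triT (2 * (2 * n + 1) : ℕ), (triF4 (t.1 - t.2.2.1) - triF4 (t.1 + t.2.2.1)) :=
    finsum_mem_congr rfl fun t ht => by
      rw [triF4_sub]
      exact ht.2.2.2.2.1
  beta_reduce at h1 h2
  rw [h3, h1] at h2
  have h4 : ∑ p ∈ Finset.HasAntidiagonal.antidiagonal n, triE (4 * p.1 + 1) * triE (4 * p.2 + 1) =
      ∑ p ∈ (Finset.HasAntidiagonal.antidiagonal (2 * (2 * n + 1))).filter (fun p => p.1 % 2 = 1),
        triE p.1 * triE p.2 := by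
    refine Finset.sum_of_injOn (fun p => (4 * p.1 + 1, 4 * p.2 + 1)) ?_ ?_ ?_ ?_
    · rintro ⟨a, b⟩ - ⟨c, d⟩ - h
      simp only [Prod.mk.injEq] at h ⊢; omega
    · rintro ⟨a, b⟩ h
      simp only [Finset.coe_filter, Finset.mem_coe, Finset.HasAntidiagonal.mem_antidiagonal, Set.mem_ofPred_eq] at h ⊢
      omega
    · rintro ⟨a, b⟩ h h'
      simp only [Finset.mem_filter, Finset.HasAntidiagonal.mem_antidiagonal] at h
      by_cases h4 : a % 4 = 1
      · exfalso; apply h'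
        refine ⟨(a / 4, b / 4), ?_, ?_⟩
        · simp only [Finset.mem_coe, Finset.HasAntidiagonal.mem_antidiagonal]; omega
        · simp only [Prod.mk.injEq]; omega
      · simp only
        rw [triE_three a (by omega), zero_mul]
    · intro p _; rfl
  have h5 : ∑ p ∈ (Finset.HasAntidiagonal.antidiagonal (2 * (2 * n + 1))).filter (fun p => p.1 % 2 = 1),
        (∑ a ∈ p.1.divisors, 2 * triChi (a : ℤ)) * (∑ b ∈ p.2.divisors, triChi (b : ℤ)) = 
        2 * ∑ p ∈ (Finset.HasAntidiagonal.antidiagonal (2 * (2 * n + 1))).filter (fun p => p.1 % 2 = 1),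
        triE p.1 * triE p.2 := by
    rw [Finset.mul_sum]
    refine Finset.sum_congr rfl fun p _ => ?_
    rw [← Finset.mul_sum, triE, triE, mul_assoc]
  rw [h5, ← h4] at h2
  have h6 : ∑ c ∈ (2 * n + 1).divisors.filter (fun c => ((2 * n + 1) / c) % 2 = 1),
      (c : ℤ) * (triF4 0 - triF4 (2 * (c : ℤ))) = 2 * triS (2 * n + 1) := by
    have hodd : ∀ c ∈ (2 * n + 1).divisors, c % 2 = 1 ∧ ((2 * n + 1) / c) % 2 = 1 := by
      intro c hc
      obtain ⟨e, he⟩ := Nat.dvd_of_mem_divisors hc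
      rw [he, Nat.mul_div_cancel_left _ (Nat.pos_of_mem_divisors hc)]
      have : Odd (c * e) := ⟨n, he.symm⟩
      rw [Nat.odd_mul, Nat.odd_iff, Nat.odd_iff] at this
      exact this
    rw [Finset.filter_true_of_mem fun c hc => (hodd c hc).2, triS, Finset.mul_sum]
    refine Finset.sum_congr rfl fun c hc => ?_
    have := (hodd c hc).1
    have e1 : triF4 0 = 1 := rfl
    have e2 : triF4 (2 * (c : ℤ)) = -1 := by
      unfold triF4; split_ifs <;> omega
    rw [e1, e2]; ring
  rw [h6] at h2
  omega

def triF6 (x : ℤ) : ℤ := x * triChi x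
def triG6 (b : ℤ) : ℤ := if b % 4 = 0 then -2 * b else if b % 4 = 2 then 2 * b else 0

lemma triF6_sub (a b : ℤ) (ha : a % 2 = 1) :
    triF6 (a - b) - triF6 (a + b) = triChi a * triG6 b := by
  have h : (a % 4 = 1 ∨ a % 4 = 3) := by omega
  have h' : (b % 4 = 0 ∨ b % 4 = 1 ∨ b % 4 = 2 ∨ b % 4 = 3) := by omega
  have e1 : (a - b) % 4 = (a % 4 - b % 4) % 4 := by omega
  have e2 : (a + b) % 4 = (a % 4 + b % 4) % 4 := by omega
  unfold triF6 triG6 triChi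
  rw [e1, e2]
  rcases h with h | h <;> rcases h' with h' | h' | h' | h' <;> rw [h, h'] <;> norm_num <;> ring

lemma triF6_Ico (k : ℕ) :
    ∑ y ∈ Finset.Ico 1 (2 * k + 1), triF6 y = -(triChi (2 * k + 1) * k) := by
  induction k with
  | zero => simp
  | succ k ih =>
    rw [show 2 * (k + 1) + 1 = 2 * k + 1 + 1 + 1 by ring, Finset.sum_Ico_succ_top (by omega),
      Finset.sum_Ico_succ_top (by omega), ih]
    have e1 : triChi ((2 * k + 1 + 1 : ℕ) : ℤ) = 0 := by
      unfold triChi; split_ifs <;> omega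
    have e2 : triChi (2 * ((k + 1 : ℕ) : ℤ) + 1) = -triChi (2 * k + 1) := by
      unfold triChi; split_ifs <;> omega
    rw [e2]
    simp only [triF6, e1]
    push_cast
    ring

lemma tri_conv6 (n : ℕ) :
    8 * ∑ p ∈ Finset.HasAntidiagonal.antidiagonal n, triE (4 * p.1 + 1) * triS (2 * p.2 + 1) =
      -∑ c ∈ (4 * n + 3).divisors, triChi c * (c : ℤ) ^ 2 := by
  have h1 := tri_liouville (4 * n + 3 : ℕ) triF6 (fun x => by
    unfold triF6; rw [triChi_neg]; ring)
  have h2 := triT_conv (4 * n + 3) triChi triG6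
  have h3 : ∑ᶠ t ∈ triT (4 * n + 3 : ℕ), triChi t.1 * triG6 t.2.2.1 =
      ∑ᶠ t ∈ triT (4 * n + 3 : ℕ), (triF6 (t.1 - t.2.2.1) - triF6 (t.1 + t.2.2.1)) :=
    finsum_mem_congr rfl fun t ht => by
      rw [triF6_sub]
      exact ht.2.2.2.2.1
  have hodd : ∀ c ∈ (4 * n + 3).divisors, c % 2 = 1 ∧ ((4 * n + 3) / c) % 2 = 1 := by
    intro c hc
    obtain ⟨e, he⟩ := Nat.dvd_of_mem_divisors hc
    rw [he, Nat.mul_div_cancel_left _ (Nat.pos_of_mem_divisors hc)]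
    have : Odd (c * e) := ⟨2 * n + 1, by omega⟩
    rw [Nat.odd_mul, Nat.odd_iff, Nat.odd_iff] at this
    exact this
  rw [h3, h1, triTA0_sum _ (by omega), triTB0_sum _ (by omega), triB0_sum _ (by omega),
    triA0_sum _ (by omega), Finset.filter_true_of_mem fun c hc => (hodd c hc).2,
    ← Finset.sum_sub_distrib, ← Finset.sum_add_distrib, ← Finset.sum_sub_distrib] at h2
  have h4 : ∑ p ∈ Finset.HasAntidiagonal.antidiagonal n, triE (4 * p.1 + 1) * (4 * triS (2 * p.2 + 1)) =
      ∑ p ∈ (Finset.HasAntidiagonal.antidiagonal (4 * n + 3)).filter (fun p => p.1 % 2 = 1),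
        triE p.1 * (∑ b ∈ p.2.divisors, triG6 b) := by
    refine Finset.sum_of_injOn (fun p => (4 * p.1 + 1, 4 * p.2 + 2)) ?_ ?_ ?_ ?_
    · rintro ⟨a, b⟩ - ⟨c, d⟩ - h
      simp only [Prod.mk.injEq] at h ⊢; omega
    · rintro ⟨a, b⟩ h
      simp only [Finset.coe_filter, Finset.mem_coe, Finset.HasAntidiagonal.mem_antidiagonal, Set.mem_ofPred_eq] at h ⊢
      omega
    · rintro ⟨a, b⟩ h h'
      simp only [Finset.mem_filter, Finset.HasAntidiagonal.mem_antidiagonal] at h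
      by_cases h4 : a % 4 = 1
      · exfalso; apply h'
        refine ⟨(a / 4, b / 4), ?_, ?_⟩
        · simp only [Finset.mem_coe, Finset.HasAntidiagonal.mem_antidiagonal]; omega
        · simp only [Prod.mk.injEq]; omega
      · simp only
        rw [triE_three a (by omega), zero_mul]
    · rintro ⟨a, b⟩ _
      simp only
      congr 1
      rw [triS, Finset.mul_sum]
      refine Finset.sum_of_injOn (fun c => 2 * c) ?_ ?_ ?_ ?_
      · intro a _ b _ h; simp only at h; omega
      · intro c hc
        simp only [Finset.mem_coe, Nat.mem_divisors] at hc ⊢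
        refine ⟨?_, by omega⟩
        rw [show 4 * b + 2 = 2 * (2 * b + 1) by ring]
        exact mul_dvd_mul_left 2 hc.1
      · intro c hc hc'
        by_cases hc2 : c % 2 = 1
        · unfold triG6; split_ifs <;> omega
        · exfalso; apply hc'
          refine ⟨c / 2, ?_, ?_⟩
          · simp only [Finset.mem_coe, Nat.mem_divisors] at hc ⊢
            refine ⟨?_, by omega⟩
            have := hc.1
            rw [show 4 * b + 2 = 2 * (2 * b + 1) by ring, show c = 2 * (c / 2) by omega] at this
            exact Nat.dvd_of_mul_dvd_mul_left (by norm_num) this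
          · simp only; omega
      · intro c hc
        obtain ⟨e, he⟩ := Nat.dvd_of_mem_divisors hc
        have : Odd (c * e) := ⟨b, he.symm⟩
        rw [Nat.odd_mul, Nat.odd_iff, Nat.odd_iff] at this
        unfold triG6; push_cast; split_ifs <;> omega
  have h5 : ∑ p ∈ Finset.HasAntidiagonal.antidiagonal n, triE (4 * p.1 + 1) * (4 * triS (2 * p.2 + 1)) = 
      4 * ∑ p ∈ Finset.HasAntidiagonal.antidiagonal n, triE (4 * p.1 + 1) * triS (2 * p.2 + 1) := by
    rw [Finset.mul_sum]
    exact Finset.sum_congr rfl fun p _ => by ring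
  rw [h5] at h4
  have h6 := triE_three (4 * n + 3) (by omega)
  change _ = ∑ p ∈ (Finset.HasAntidiagonal.antidiagonal (4 * n + 3)).filter (fun p => p.1 % 2 = 1),
        triE p.1 * (∑ b ∈ p.2.divisors, triG6 b) at h2
  rw [← h4] at h2
  have h7 : ∀ c ∈ (4 * n + 3).divisors,
      2 * ((((c / 2 : ℕ) : ℤ) * triF6 0 - ((c / 2 : ℕ) : ℤ) * triF6 c +
        ((((4 * n + 3) / c : ℕ) : ℤ) - 1) * triF6 c) - ∑ y ∈ Finset.Ico 1 c, triF6 y) =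
      (2 * (4 * n + 3 : ℕ) - 1) * triChi c - triChi c * (c : ℤ) ^ 2 := by
    intro c hc
    have hc2 := (hodd c hc).1
    obtain ⟨e, he⟩ := Nat.dvd_of_mem_divisors hc
    obtain ⟨k, rfl⟩ : ∃ k, c = 2 * k + 1 := ⟨c / 2, by omega⟩
    rw [he, Nat.mul_div_cancel_left _ (by omega), triF6_Ico,
      show (2 * k + 1) / 2 = k by omega]
    simp only [triF6]
    push_cast
    ring
  have h8 := Finset.sum_congr rfl h7
  rw [← Finset.mul_sum, h2, Finset.sum_sub_distrib, ← Finset.mul_sum] at h8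
  rw [triE] at h6
  rw [h6] at h8
  linarith

/-! ### Sums of two squares -/

def triSg (x : ℤ) : ℤ := if x % 2 = 0 then 1 else -1

def triX (N : ℕ) : Finset ℤ := (Finset.Icc (-(N : ℤ)) N).filter (fun x => x ^ 2 ≤ N)
def triXl (N : ℕ) : Finset ℤ := (Finset.Icc (-(N : ℤ)) N).filter (fun x => x ^ 2 < N)
def triXs (N : ℕ) : Finset ℤ := (Finset.Icc (-(N : ℤ)) N).filter (fun x => x ^ 2 = N)

lemma mem_triX {N : ℕ} {x : ℤ} : x ∈ triX N ↔ x ^ 2 ≤ N := by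
  simp only [triX, Finset.mem_filter, Finset.mem_Icc]
  refine ⟨fun h => h.2, fun h => ⟨⟨?_, ?_⟩, h⟩⟩ <;> nlinarith [sq_nonneg (x - 1), sq_nonneg (x + 1), sq_nonneg x]

lemma mem_triXl {N : ℕ} {x : ℤ} : x ∈ triXl N ↔ x ^ 2 < N := by
  have := @mem_triX N x
  simp only [triX, triXl, Finset.mem_filter] at *
  exact ⟨fun h => h.2, fun h => ⟨(this.2 h.le).1, h⟩⟩

lemma mem_triXs {N : ℕ} {x : ℤ} : x ∈ triXs N ↔ x ^ 2 = N := by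
  have := @mem_triX N x
  simp only [triX, triXs, Finset.mem_filter] at *
  exact ⟨fun h => h.2, fun h => ⟨(this.2 h.le).1, h⟩⟩

lemma triX_split (N : ℕ) (f : ℤ → ℤ) :
    ∑ x ∈ triX N, f x = ∑ x ∈ triXl N, f x + ∑ x ∈ triXs N, f x := by
  rw [← Finset.sum_union]
  · refine Finset.sum_congr ?_ fun _ _ => rfl
    ext x
    rw [Finset.mem_union, mem_triX, mem_triXl, mem_triXs, le_iff_lt_or_eq]
  · rw [Finset.disjoint_left]
    intro x h h'
    rw [mem_triXl] at h; rw [mem_triXs] at h'; omega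

def triH (f : ℕ → ℤ) (K : ℕ) : ℤ := if K % 2 = 0 then triSg ((K / 2 : ℕ) : ℤ) * f (K / 2) else 0

def triRec (f : ℕ → ℤ) (N : ℕ) : Prop :=
  ∑ x ∈ triX N, triSg x * f ((N - x ^ 2 : ℤ).toNat) = ∑ x ∈ triX N, triH f ((N - x ^ 2 : ℤ).toNat)

lemma triRec_unique (f g : ℕ → ℤ) (h0 : f 0 = g 0) (hf : ∀ N, 0 < N → triRec f N)
    (hg : ∀ N, 0 < N → triRec g N) (N : ℕ) : f N = g N := by
  induction N using Nat.strong_induction_on with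
  | _ N ih =>
  rcases Nat.eq_zero_or_pos N with rfl | hN
  · exact h0
  have h1 := hf N hN
  have h2 := hg N hN
  unfold triRec at h1 h2
  have h3 : ∑ x ∈ triX N, triH f ((N - x ^ 2 : ℤ).toNat) =
      ∑ x ∈ triX N, triH g ((N - x ^ 2 : ℤ).toNat) := by
    refine Finset.sum_congr rfl fun x hx => ?_
    unfold triH
    have : 0 ≤ x ^ 2 := sq_nonneg x
    rw [ih ((N - x ^ 2 : ℤ).toNat / 2) (by omega)]
  have h4 : ∑ x ∈ triX N, (triSg x * f ((N - x ^ 2 : ℤ).toNat) - triSg x * g ((N - x ^ 2 : ℤ).toNat))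
      = f N - g N := by
    rw [Finset.sum_eq_single 0]
    · simp [triSg]
    · intro x hx hx0
      have : 0 < x ^ 2 := by positivity
      rw [ih ((N - x ^ 2 : ℤ).toNat) (by omega), sub_self]
    · intro h
      exact absurd (mem_triX.2 (by simp)) h
  rw [Finset.sum_sub_distrib] at h4
  omega

def triR2 (K : ℕ) : Finset (ℤ × ℤ) :=
  (triX K ×ˢ triX K).filter (fun p => p.1 ^ 2 + p.2 ^ 2 = K)

lemma mem_triR2 {K : ℕ} {p : ℤ × ℤ} : p ∈ triR2 K ↔ p.1 ^ 2 + p.2 ^ 2 = K := by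
  simp only [triR2, Finset.mem_filter, Finset.mem_product, mem_triX]
  refine ⟨fun h => h.2, fun h => ⟨⟨?_, ?_⟩, h⟩⟩ <;> nlinarith [sq_nonneg p.1, sq_nonneg p.2]

def triR (K : ℕ) : ℤ := (triR2 K).card

lemma tri_sq_mod (x : ℤ) : x ^ 2 % 2 = x % 2 := by
  rcases Int.emod_two_eq_zero_or_one x with h | h <;> simp [pow_two, Int.mul_emod, h]

lemma triR2_sg (K : ℕ) : ∑ p ∈ triR2 K, triSg p.1 = triH triR K := by
  unfold triH
  split_ifs with hK
  · obtain ⟨J, rfl⟩ : ∃ J, K = 2 * J := ⟨K / 2, by omega⟩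
    rw [Nat.mul_div_cancel_left _ (by norm_num), triR, Finset.card_eq_sum_ones, Nat.cast_sum,
      Finset.mul_sum]
    refine Finset.sum_nbij' (fun p => ((p.1 + p.2) / 2, (p.1 - p.2) / 2))
      (fun p => (p.1 + p.2, p.1 - p.2)) ?_ ?_ ?_ ?_ ?_
    · rintro ⟨u, v⟩ h
      rw [mem_triR2] at h ⊢
      simp only at h ⊢
      have h1 := tri_sq_mod u
      have h2 := tri_sq_mod v
      push_cast at h
      obtain ⟨s, hs⟩ : ∃ s, u + v = 2 * s := ⟨(u + v) / 2, by omega⟩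
      obtain ⟨t, ht⟩ : ∃ t, u - v = 2 * t := ⟨(u - v) / 2, by omega⟩
      rw [hs, ht, Int.mul_ediv_cancel_left _ (by norm_num),
        Int.mul_ediv_cancel_left _ (by norm_num)]
      have hu : u = s + t := by omega
      have hv : v = s - t := by omega
      subst hu hv
      linarith
    · rintro ⟨u, v⟩ h
      rw [mem_triR2] at h ⊢
      simp only at h ⊢
      push_cast
      linarith
    · rintro ⟨u, v⟩ h
      rw [mem_triR2] at h
      simp only at h ⊢
      have h1 := tri_sq_mod u
      have h2 := tri_sq_mod v
      push_cast at h
      simp only [Prod.mk.injEq]; omega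
    · rintro ⟨u, v⟩ h
      simp only [Prod.mk.injEq]; omega
    · rintro ⟨u, v⟩ h
      rw [mem_triR2] at h
      simp only at h ⊢
      have h1 := tri_sq_mod u
      have h2 := tri_sq_mod v
      push_cast at h
      obtain ⟨s, hs⟩ : ∃ s, u + v = 2 * s := ⟨(u + v) / 2, by omega⟩
      obtain ⟨t, ht⟩ : ∃ t, u - v = 2 * t := ⟨(u - v) / 2, by omega⟩
      have hu : u = s + t := by omega
      have hv : v = s - t := by omega
      have h3 := tri_sq_mod s
      have h4 := tri_sq_mod t
      subst hu hv
      have h5 : s ^ 2 + t ^ 2 = J := by linarith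
      unfold triSg
      simp only [Nat.cast_one, mul_one]
      split_ifs <;> omega
  · have h : ∑ p ∈ triR2 K, triSg p.1 = ∑ p ∈ triR2 K, -triSg p.1 := by
      refine Finset.sum_nbij' (fun p => (p.2, p.1)) (fun p => (p.2, p.1)) ?_ ?_ ?_ ?_ ?_
      · intro p h; rw [mem_triR2] at h ⊢; rw [← h]; ring
      · intro p h; rw [mem_triR2] at h ⊢; rw [← h]; ring
      · intro p _; rfl
      · intro p _; rfl
      · rintro ⟨u, v⟩ h
        rw [mem_triR2] at h
        simp only at h ⊢
        have h1 := tri_sq_mod u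
        have h2 := tri_sq_mod v
        unfold triSg
        split_ifs <;> omega
    rw [Finset.sum_neg_distrib] at h
    omega

lemma triR_rec (N : ℕ) : triRec triR N := by
  unfold triRec
  have h1 : ∀ x ∈ triX N, triSg x * triR ((N - x ^ 2 : ℤ).toNat) =
      ∑ p ∈ triR2 ((N - x ^ 2 : ℤ).toNat), triSg x := by
    intro x _
    rw [Finset.sum_const, triR, nsmul_eq_mul, mul_comm]
  have h2 : ∀ x ∈ triX N, triH triR ((N - x ^ 2 : ℤ).toNat) =
      ∑ p ∈ triR2 ((N - x ^ 2 : ℤ).toNat), triSg p.1 := fun x _ => (triR2_sg _).symm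
  rw [Finset.sum_congr rfl h1, Finset.sum_congr rfl h2, Finset.sum_sigma', Finset.sum_sigma']
  refine Finset.sum_nbij' (fun q => ⟨q.2.2, (q.1, q.2.1)⟩) (fun q => ⟨q.2.1, (q.2.2, q.1)⟩)
    ?_ ?_ ?_ ?_ ?_
  · rintro ⟨x, y, z⟩ h
    rw [Finset.mem_sigma, mem_triR2, mem_triX] at h ⊢
    simp only at h ⊢
    have := sq_nonneg x
    have := sq_nonneg y
    have := sq_nonneg z
    omega
  · rintro ⟨x, y, z⟩ h
    rw [Finset.mem_sigma, mem_triR2, mem_triX] at h ⊢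
    simp only at h ⊢
    have := sq_nonneg x
    have := sq_nonneg y
    have := sq_nonneg z
    omega
  · intro _ _; rfl
  · intro _ _; rfl
  · intro _ _; rfl

/-- Solutions of `x ^ 2 + n m = N`, `n, m > 0`. -/
def triV (N : ℕ) : Set (ℤ × ℤ × ℤ) := {t | 0 < t.2.1 ∧ 0 < t.2.2 ∧ t.1 ^ 2 + t.2.1 * t.2.2 = N}

lemma triV_finite (N : ℕ) : (triV N).Finite := by
  have : ((Set.Icc (-(N : ℤ)) N) ×ˢ (Set.Icc (0 : ℤ) N) ×ˢ (Set.Icc (0 : ℤ) N)).Finite :=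
    (Set.finite_Icc _ _).prod ((Set.finite_Icc _ _).prod (Set.finite_Icc _ _))
  refine this.subset ?_
  rintro ⟨x, n, m⟩ ⟨h1, h2, h3⟩
  simp only at h1 h2 h3
  have h4 := mul_pos h1 h2
  have h5 : x ∈ triX N := mem_triX.2 (by omega)
  have h6 := sq_nonneg x
  rw [triX, Finset.mem_filter, Finset.mem_Icc] at h5
  simp only [Set.mem_prod, Set.mem_Icc]
  refine ⟨h5.1, ⟨?_, ?_⟩, ⟨?_, ?_⟩⟩ <;> nlinarith

lemma triV_sum (N : ℕ) (f : ℤ → ℤ → ℤ → ℤ) :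
    ∑ᶠ t ∈ triV N, f t.1 t.2.1 t.2.2 =
      ∑ x ∈ triXl N, ∑ p ∈ ((N - x ^ 2 : ℤ).toNat).divisorsAntidiagonal, f x p.1 p.2 := by
  rw [Finset.sum_sigma']
  refine tri_fs_finset (fun q => (q.1, ((q.2.1 : ℤ), (q.2.2 : ℤ))))
    (fun t => ⟨t.1, (t.2.1.toNat, t.2.2.toNat)⟩) ?_ ?_ ?_ ?_ ?_
  · rintro ⟨x, n, m⟩ h
    simp only [Finset.mem_sigma, Nat.mem_divisorsAntidiagonal, mem_triXl] at h
    obtain ⟨h1, h2, h3⟩ := h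
    have hn : 0 < n := Nat.pos_of_ne_zero fun h => h3 (by rw [← h2, h, zero_mul])
    have hm : 0 < m := Nat.pos_of_ne_zero fun h => h3 (by rw [← h2, h, mul_zero])
    refine ⟨?_, ?_, ?_⟩ <;> simp only
    · omega
    · omega
    have : ((n * m : ℕ) : ℤ) = N - x ^ 2 := by rw [h2]; omega
    push_cast at this
    linarith
  · rintro ⟨x, n, m⟩ ⟨h1, h2, h3⟩
    simp only at h1 h2 h3
    have := mul_pos h1 h2
    lift n to ℕ using h1.le
    lift m to ℕ using h2.le
    simp only [Finset.mem_sigma, Nat.mem_divisorsAntidiagonal, mem_triXl, Int.toNat_natCast]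
    refine ⟨by omega, ?_, by omega⟩
    zify
    omega
  · rintro ⟨x, n, m⟩ h
    simp
  · rintro ⟨x, n, m⟩ ⟨h1, h2, h3⟩
    simp only at h1 h2 h3
    simp only [Prod.mk.injEq, true_and, and_true]
    omega
  · intro _ _; rfl

def triGg (n k : ℤ) : ℤ := triSg n * triChi (k - n)

def triU (N : ℕ) : Set (ℤ × ℤ × ℤ) :=
  {t | 0 < t.2.1 ∧ 0 < t.2.2 - t.2.1 + 2 * t.1 ∧ t.1 ^ 2 + t.2.1 * t.2.2 = N}
def triUp (N : ℕ) : Set (ℤ × ℤ × ℤ) := {t | t ∈ triU N ∧ 0 < t.2.2}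
def triUm (N : ℕ) : Set (ℤ × ℤ × ℤ) := {t | t ∈ triU N ∧ t.2.2 < 0}
def triUz (N : ℕ) : Set (ℤ × ℤ × ℤ) := {t | t ∈ triU N ∧ t.2.2 = 0}

lemma triU_mem1 {N : ℕ} (t : ℤ × ℤ × ℤ) (ht : t ∈ triV N) :
    (t.1 + t.2.1, t.2.1, t.2.2 - t.2.1 - 2 * t.1) ∈ triU N := by
  obtain ⟨x, n, m⟩ := t
  obtain ⟨h1, h2, h3⟩ := ht
  simp only at h1 h2 h3
  refine ⟨h1, ?_, ?_⟩ <;> simp only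
  · omega
  · rw [← h3]; ring

lemma triU_mem2 {N : ℕ} (t : ℤ × ℤ × ℤ) (ht : t ∈ triU N) :
    (t.1 - t.2.1, t.2.1, t.2.2 - t.2.1 + 2 * t.1) ∈ triV N := by
  obtain ⟨x, n, m⟩ := t
  obtain ⟨h1, h2, h3⟩ := ht
  simp only at h1 h2 h3
  refine ⟨h1, ?_, ?_⟩ <;> simp only
  · omega
  · rw [← h3]; ring

lemma triU_finite (N : ℕ) : (triU N).Finite := by
  refine tri_fin_bij (fun t => (t.1 + t.2.1, t.2.1, t.2.2 - t.2.1 - 2 * t.1))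
    (fun t => (t.1 - t.2.1, t.2.1, t.2.2 - t.2.1 + 2 * t.1)) (triV_finite N)
    (fun t h => triU_mem2 t h) ?_
  rintro ⟨x, n, m⟩ _
  simp only [Prod.mk.injEq, true_and, and_true]; omega

lemma tri_two_mul_mod (a : ℤ) : (2 * a) % 4 = 2 * (a % 2) := by omega

lemma triChi_shift (m a : ℤ) : triChi (m - 2 * a) = triSg a * triChi m := by
  unfold triChi triSg
  split_ifs <;> omega

lemma triSg_add (a b : ℤ) : triSg (a + b) = triSg a * triSg b := by
  unfold triSg
  split_ifs <;> omega

lemma triSg_sq (a : ℤ) : triSg a * triSg a = 1 := by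
  unfold triSg
  split_ifs <;> omega

lemma triV_eq_U (N : ℕ) :
    ∑ᶠ t ∈ triV N, triSg t.1 * triChi t.2.2 = ∑ᶠ t ∈ triU N, triGg t.2.1 t.2.2 := by
  refine tri_fs_bij (fun t => (t.1 + t.2.1, t.2.1, t.2.2 - t.2.1 - 2 * t.1))
    (fun t => (t.1 - t.2.1, t.2.1, t.2.2 - t.2.1 + 2 * t.1)) (fun t h => triU_mem1 t h)
    (fun t h => triU_mem2 t h) ?_ ?_ ?_
  · rintro ⟨x, n, m⟩ _
    simp only [Prod.mk.injEq, true_and, and_true]; omega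
  · rintro ⟨x, n, m⟩ _
    simp only [Prod.mk.injEq, true_and, and_true]; omega
  · rintro ⟨x, n, m⟩ _
    simp only [triGg]
    rw [show m - n - 2 * x - n = m - 2 * (x + n) by ring, triChi_shift, triSg_add]
    linear_combination (-(triSg x * triChi m)) * triSg_sq n

lemma triU_split (N : ℕ) (f : ℤ × ℤ × ℤ → ℤ) :
    ∑ᶠ t ∈ triU N, f t = ∑ᶠ t ∈ triUp N, f t + ∑ᶠ t ∈ triUm N, f t + ∑ᶠ t ∈ triUz N, f t := by
  have h : triU N = (triUp N ∪ triUm N) ∪ triUz N := by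
    ext t
    simp only [triUp, triUm, triUz, Set.mem_union, Set.mem_ofPred_eq]
    have := lt_trichotomy t.2.2 0
    tauto
  have f1 : (triUp N).Finite := (triU_finite N).subset fun _ h => h.1
  have f2 : (triUm N).Finite := (triU_finite N).subset fun _ h => h.1
  have f3 : (triUz N).Finite := (triU_finite N).subset fun _ h => h.1
  have d1 : Disjoint (triUp N) (triUm N) := Set.disjoint_left.2 fun t h h' => by
    have := h.2; have := h'.2; omega
  have d2 : Disjoint (triUp N ∪ triUm N) (triUz N) := Set.disjoint_left.2 fun t h h' => by
    have h2 := h'.2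
    rcases h with h | h <;> have := h.2 <;> omega
  rw [h, finsum_mem_union d2 (f1.union f2) f3, finsum_mem_union d1 f1 f2]

lemma triGg_swap (n k : ℤ) : triGg k n = triGg n k := by
  unfold triGg triSg triChi
  split_ifs <;> omega

lemma triUm_sum (N : ℕ) : ∑ᶠ t ∈ triUm N, triGg t.2.1 t.2.2 = 0 := by
  have h : ∑ᶠ t ∈ triUm N, triGg t.2.1 t.2.2 = ∑ᶠ t ∈ triUm N, -triGg t.2.1 t.2.2 := by
    have key : ∀ t ∈ triUm N, (t.1, -t.2.2, -t.2.1) ∈ triUm N := by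
      rintro ⟨y, n, k⟩ ⟨⟨h1, h2, h3⟩, h4⟩
      simp only at h1 h2 h3 h4
      refine ⟨⟨?_, ?_, ?_⟩, ?_⟩ <;> simp only
      · omega
      · omega
      · rw [← h3]; ring
      · omega
    refine tri_fs_bij (fun t => (t.1, -t.2.2, -t.2.1)) (fun t => (t.1, -t.2.2, -t.2.1)) key key
      ?_ ?_ ?_
    · rintro ⟨y, n, k⟩ _; simp
    · rintro ⟨y, n, k⟩ _; simp
    · rintro ⟨y, n, k⟩ _
      simp only [triGg]
      unfold triSg triChi
      split_ifs <;> omega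
  rw [finsum_mem_neg_distrib _ ((triU_finite N).subset fun _ h => h.1)] at h
  omega

lemma triUp_sum (N : ℕ) :
    2 * ∑ᶠ t ∈ triUp N, triGg t.2.1 t.2.2 = ∑ᶠ t ∈ triV N, triGg t.2.1 t.2.2 := by
  let h : ℤ × ℤ × ℤ → ℤ := fun t =>
    if 0 < t.2.2 - t.2.1 + 2 * t.1 then triGg t.2.1 t.2.2 else 0
  have e1 : ∑ᶠ t ∈ triUp N, triGg t.2.1 t.2.2 = ∑ᶠ t ∈ triV N, h t := by
    have hs : triV N = triUp N ∪ (triV N \ triUp N) := by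
      rw [Set.union_sdiff_cancel]
      rintro ⟨y, n, k⟩ ⟨⟨h1, h2, h3⟩, h4⟩
      exact ⟨h1, h4, h3⟩
    rw [hs, finsum_mem_union Set.disjoint_sdiff_right ((triU_finite N).subset fun _ h => h.1)
      ((triV_finite N).subset fun _ h => h.1)]
    have z : ∑ᶠ t ∈ triV N \ triUp N, h t = ∑ᶠ t ∈ triV N \ triUp N, (0 : ℤ) := by
      refine finsum_mem_congr rfl ?_
      rintro ⟨y, n, k⟩ ⟨⟨h1, h2, h3⟩, h4⟩
      simp only [h]
      rw [if_neg]
      intro h5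
      exact h4 ⟨⟨h1, h5, h3⟩, h2⟩
    rw [z, finsum_mem_zero, add_zero]
    refine finsum_mem_congr rfl ?_
    rintro ⟨y, n, k⟩ ⟨⟨h1, h2, h3⟩, h4⟩
    simp only [h]
    rw [if_pos h2]
  have e2 : ∑ᶠ t ∈ triV N, h t = ∑ᶠ t ∈ triV N, h (-t.1, t.2.2, t.2.1) := by
    have key : ∀ t ∈ triV N, (-t.1, t.2.2, t.2.1) ∈ triV N := by
      rintro ⟨y, n, k⟩ ⟨h1, h2, h3⟩
      exact ⟨h2, h1, by rw [← h3]; ring⟩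
    refine tri_fs_bij (fun t => (-t.1, t.2.2, t.2.1)) (fun t => (-t.1, t.2.2, t.2.1)) key key ?_ ?_ ?_
    · rintro ⟨y, n, k⟩ _; simp
    · rintro ⟨y, n, k⟩ _; simp
    · rintro ⟨y, n, k⟩ _; simp
  have e3 : ∑ᶠ t ∈ triV N, (h t + h (-t.1, t.2.2, t.2.1)) = ∑ᶠ t ∈ triV N, triGg t.2.1 t.2.2 := by
    refine finsum_mem_congr rfl ?_
    rintro ⟨y, n, k⟩ _
    simp only [h]
    rw [triGg_swap n k]
    rcases lt_trichotomy (k - n + 2 * y) 0 with h1 | h1 | h1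
    · rw [if_neg (by omega), if_pos (by omega), zero_add]
    · rw [if_neg (by omega), if_neg (by omega)]
      unfold triGg triChi
      split_ifs <;> omega
    · rw [if_pos (by omega), if_neg (by omega), add_zero]
  rw [finsum_mem_add_distrib (triV_finite N), ← e2, ← e1] at e3
  omega

lemma triXs_neg (N : ℕ) (f : ℤ → ℤ) : ∑ x ∈ triXs N, f x = ∑ x ∈ triXs N, f (-x) := by
  refine Finset.sum_nbij' (fun x => -x) (fun x => -x) ?_ ?_ ?_ ?_ ?_
  · intro x h; rw [mem_triXs] at h ⊢; rw [neg_sq]; exact h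
  · intro x h; rw [mem_triXs] at h ⊢; rw [neg_sq]; exact h
  · intro x _; simp
  · intro x _; simp
  · intro x _; simp

lemma tri_chi_Ico (s : ℕ) : ∑ n ∈ Finset.Ico 1 (2 * (s + 1)), triChi n = ((s + 1 : ℕ) : ℤ) % 2 := by
  induction s with
  | zero => rfl
  | succ s ih =>
    rw [show 2 * (s + 1 + 1) = 2 * (s + 1) + 1 + 1 by ring, Finset.sum_Ico_succ_top (by omega),
      Finset.sum_Ico_succ_top (by omega), ih]
    unfold triChi
    split_ifs <;> omega

lemma triUz_sum (N : ℕ) (hN : 0 < N) :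
    4 * ∑ᶠ t ∈ triUz N, triGg t.2.1 t.2.2 = ∑ x ∈ triXs N, (1 - triSg x) := by
  have e1 : ∑ᶠ t ∈ triUz N, triGg t.2.1 t.2.2 =
      ∑ x ∈ triXs N, ∑ n ∈ Finset.Ico 1 (2 * x).toNat, triChi n := by
    rw [Finset.sum_sigma']
    refine tri_fs_finset (fun q => (q.1, (q.2 : ℤ), 0)) (fun t => ⟨t.1, t.2.1.toNat⟩) ?_ ?_ ?_ ?_ ?_
    · rintro ⟨x, n⟩ h
      simp only [Finset.mem_sigma, mem_triXs, Finset.mem_Ico] at h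
      refine ⟨⟨?_, ?_, ?_⟩, rfl⟩ <;> simp only
      · omega
      · omega
      · rw [h.1]; ring
    · rintro ⟨y, n, k⟩ ⟨⟨h1, h2, h3⟩, h4⟩
      simp only at h1 h2 h3 h4
      subst h4
      simp only [Finset.mem_sigma, mem_triXs, Finset.mem_Ico]
      refine ⟨by rw [← h3]; ring, ?_⟩
      omega
    · rintro ⟨x, n⟩ _; simp
    · rintro ⟨y, n, k⟩ ⟨⟨h1, h2, h3⟩, h4⟩
      simp only at h1 h2 h3 h4
      simp only [Prod.mk.injEq, true_and, and_true]; omega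
    · rintro ⟨x, n⟩ _
      simp only [triGg]
      unfold triSg triChi
      split_ifs <;> omega
  have e2 := triXs_neg N (fun x => ∑ n ∈ Finset.Ico 1 (2 * x).toNat, triChi n)
  have e3 : ∑ x ∈ triXs N, 2 * ((∑ n ∈ Finset.Ico 1 (2 * x).toNat, triChi n) +
      (∑ n ∈ Finset.Ico 1 (2 * (-x)).toNat, triChi n)) = ∑ x ∈ triXs N, (1 - triSg x) := by
    refine Finset.sum_congr rfl fun x hx => ?_
    rw [mem_triXs] at hx
    have hx0 : x ≠ 0 := by rintro rfl; simp at hx; omega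
    rcases lt_or_gt_of_ne hx0 with h | h
    · obtain ⟨s, rfl⟩ : ∃ s : ℕ, x = -((s + 1 : ℕ) : ℤ) := ⟨(-x - 1).toNat, by omega⟩
      rw [show (2 * -((s + 1 : ℕ) : ℤ)).toNat = 0 by omega,
        show (2 * (- -((s + 1 : ℕ) : ℤ))).toNat = 2 * (s + 1) by omega, tri_chi_Ico]
      simp only [Finset.Ico_eq_empty_of_le (Nat.zero_le 1), Finset.sum_empty]
      unfold triSg; split_ifs <;> omega
    · obtain ⟨s, rfl⟩ : ∃ s : ℕ, x = ((s + 1 : ℕ) : ℤ) := ⟨(x - 1).toNat, by omega⟩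
      rw [show (2 * -((s + 1 : ℕ) : ℤ)).toNat = 0 by omega,
        show (2 * (((s + 1 : ℕ) : ℤ))).toNat = 2 * (s + 1) by omega, tri_chi_Ico]
      simp only [Finset.Ico_eq_empty_of_le (Nat.zero_le 1), Finset.sum_empty]
      unfold triSg; split_ifs <;> omega
  rw [← Finset.mul_sum, Finset.sum_add_distrib, ← e2, ← e1] at e3
  omega

lemma tri_g_sum (K : ℕ) (hK : 0 < K) :
    2 * ∑ p ∈ K.divisorsAntidiagonal, triGg p.1 p.2 = triH (fun k => 4 * triE k) K := by
  unfold triH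
  split_ifs with h
  · obtain ⟨J, rfl⟩ : ∃ J, K = 2 * J := ⟨K / 2, by omega⟩
    rw [Nat.mul_div_cancel_left _ (by norm_num)]
    let q : ℕ × ℕ → ℤ := fun p => if p.1 % 2 = 0 then triChi ((p.2 : ℤ) - p.1) else 0
    have e1 : ∑ p ∈ (2 * J).divisorsAntidiagonal, triGg p.1 p.2 =
        ∑ p ∈ (2 * J).divisorsAntidiagonal, (q p + q p.swap) := by
      refine Finset.sum_congr rfl ?_
      rintro ⟨n, m⟩ hp
      have hE : Even (n * m) := ⟨J, by rw [(Nat.mem_divisorsAntidiagonal.1 hp).1]; ring⟩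
      rw [Nat.even_mul, Nat.even_iff, Nat.even_iff] at hE
      simp only [q, Prod.swap, triGg]
      unfold triSg triChi
      split_ifs <;> omega
    have e2 : ∑ p ∈ (2 * J).divisorsAntidiagonal, q p.swap = ∑ p ∈ (2 * J).divisorsAntidiagonal, q p := by
      refine Finset.sum_nbij' Prod.swap Prod.swap ?_ ?_ ?_ ?_ ?_
      · intro p hp; rw [Nat.swap_mem_divisorsAntidiagonal]; exact hp
      · intro p hp; rw [Nat.swap_mem_divisorsAntidiagonal]; exact hp
      · intro p _; simp
      · intro p _; simp
      · intro p _; rfl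
    have e3 : ∑ p ∈ J.divisorsAntidiagonal, triSg J * triChi p.2 =
        ∑ p ∈ (2 * J).divisorsAntidiagonal, q p := by
      refine Finset.sum_of_injOn (fun p => (2 * p.1, p.2)) ?_ ?_ ?_ ?_
      · rintro ⟨a, b⟩ - ⟨c, d⟩ - h
        simp only [Prod.mk.injEq] at h ⊢; omega
      · rintro ⟨a, b⟩ h
        simp only [Finset.mem_coe, Nat.mem_divisorsAntidiagonal] at h ⊢
        refine ⟨by rw [← h.1]; ring, by omega⟩
      · rintro ⟨a, b⟩ h h'
        simp only [q]
        rw [if_neg]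
        intro ha
        apply h'
        refine ⟨(a / 2, b), ?_, ?_⟩
        · simp only [Finset.mem_coe, Nat.mem_divisorsAntidiagonal] at h ⊢
          obtain ⟨c, rfl⟩ : ∃ c, a = 2 * c := ⟨a / 2, by omega⟩
          rw [Nat.mul_div_cancel_left _ (by norm_num)]
          rw [mul_assoc] at h
          omega
        · simp only [Prod.mk.injEq, and_true]; omega
      · rintro ⟨a, b⟩ h
        rw [Nat.mem_divisorsAntidiagonal] at h
        simp only [q]
        rw [if_pos (by omega)]
        push_cast
        rw [triChi_shift, ← h.1]
        by_cases hb : b % 2 = 1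
        · have : ((a * b : ℕ) : ℤ) % 2 = (a : ℤ) % 2 := by
            push_cast
            rw [Int.mul_emod, show (b : ℤ) % 2 = 1 by omega]; simp
          simp only [triSg, this]
        · have : triChi b = 0 := by unfold triChi; split_ifs <;> omega
          rw [this]; simp
    have e4 : ∑ p ∈ J.divisorsAntidiagonal, triChi p.2 = triE J := by
      rw [triE]
      exact Nat.sum_divisorsAntidiagonal' (fun _ d => triChi (d : ℤ))
    rw [← Finset.mul_sum, e4] at e3
    rw [e1, Finset.sum_add_distrib, e2, ← e3]
    ring
  · rw [Finset.sum_eq_zero, mul_zero]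
    rintro ⟨n, m⟩ hp
    have hE : Odd (n * m) := by rw [(Nat.mem_divisorsAntidiagonal.1 hp).1, Nat.odd_iff]; omega
    rw [Nat.odd_mul, Nat.odd_iff, Nat.odd_iff] at hE
    unfold triGg triSg triChi
    simp only
    split_ifs <;> omega

def triEe (K : ℕ) : ℤ := if K = 0 then 1 else 4 * triE K

lemma triEe_rec (N : ℕ) (hN : 0 < N) : triRec triEe N := by
  unfold triRec
  rw [triX_split, triX_split]
  have a1 : ∑ x ∈ triXl N, triSg x * triEe ((N - x ^ 2 : ℤ).toNat) =
      4 * ∑ᶠ t ∈ triV N, triSg t.1 * triChi t.2.2 := by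
    rw [triV_sum N (fun x n m => triSg x * triChi m), Finset.mul_sum]
    refine Finset.sum_congr rfl fun x hx => ?_
    rw [mem_triXl] at hx
    rw [triEe, if_neg (by omega), triE, ← Finset.mul_sum]
    have := Nat.sum_divisorsAntidiagonal' (n := (N - x ^ 2 : ℤ).toNat) (fun _ d => triChi (d : ℤ))
    rw [this]; ring
  have a2 : ∑ x ∈ triXl N, triH triEe ((N - x ^ 2 : ℤ).toNat) =
      2 * ∑ᶠ t ∈ triV N, triGg t.2.1 t.2.2 := by
    rw [triV_sum N (fun x n m => triGg n m), Finset.mul_sum]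
    refine Finset.sum_congr rfl fun x hx => ?_
    rw [mem_triXl] at hx
    rw [tri_g_sum _ (by omega)]
    unfold triH
    split_ifs
    · rw [triEe, if_neg (by omega)]
    · rfl
  have a3 : ∑ x ∈ triXs N, triSg x * triEe ((N - x ^ 2 : ℤ).toNat) = ∑ x ∈ triXs N, triSg x := by
    refine Finset.sum_congr rfl fun x hx => ?_
    rw [mem_triXs] at hx
    rw [hx]; simp [triEe]
  have a4 : ∑ x ∈ triXs N, triH triEe ((N - x ^ 2 : ℤ).toNat) = ∑ x ∈ triXs N, 1 := by
    refine Finset.sum_congr rfl fun x hx => ?_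
    rw [mem_triXs] at hx
    rw [hx]; simp [triEe, triH, triSg]
  have b1 := triUz_sum N hN
  have b2 := triUp_sum N
  have b3 := triUm_sum N
  have b4 := triV_eq_U N
  rw [triU_split] at b4
  rw [Finset.sum_sub_distrib] at b1
  rw [a1, a2, a3, a4]
  omega

lemma triR_eq (N : ℕ) (hN : 0 < N) : triR N = 4 * triE N := by
  have h0 : triR 0 = triEe 0 := by
    have : triR2 0 = {(0, 0)} := by
      ext ⟨u, v⟩
      rw [mem_triR2, Finset.mem_singleton, Prod.mk.injEq]
      constructor
      · intro h
        simp only [Nat.cast_zero] at h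
        constructor <;> nlinarith [sq_nonneg u, sq_nonneg v]
      · rintro ⟨rfl, rfl⟩; simp
    simp [triR, this, triEe]
  rw [triRec_unique triR triEe h0 (fun N _ => triR_rec N) triEe_rec N, triEe, if_neg hN.ne']

/-! ### Counting representations -/

lemma tri_nonneg (x : ℤ) : 0 ≤ x * (x + 1) / 2 := by
  apply Int.ediv_nonneg _ (by norm_num)
  rcases le_or_gt 0 x with h | h <;> nlinarith

lemma tri_rep_finite (s n : ℕ) :
    Finite {x : Fin s → ℤ // ∑ i, x i * (x i + 1) / 2 = (n : ℤ)} := by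
  have h : (Set.pi Set.univ (fun _ : Fin s => Set.Icc (-(2 * n + 2 : ℤ)) (2 * n + 2))).Finite :=
    Set.Finite.pi fun _ => Set.finite_Icc _ _
  refine Set.Finite.to_subtype (s := {x : Fin s → ℤ | ∑ i, x i * (x i + 1) / 2 = (n : ℤ)})
    (h.subset ?_)
  intro x hx i _
  have h1 := Finset.single_le_sum (f := fun i => x i * (x i + 1) / 2)
    (fun i _ => tri_nonneg (x i)) (Finset.mem_univ i)
  have hx' : ∑ i, x i * (x i + 1) / 2 = (n : ℤ) := hx
  have h2 : x i * (x i + 1) / 2 ≤ n := by rw [← hx']; exact h1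
  have h3 : x i * (x i + 1) ≤ 2 * n + 1 := by omega
  constructor <;> nlinarith

lemma tri_rep_add (a b n : ℕ) :
    repTriangles (a + b) n =
      ∑ p ∈ Finset.HasAntidiagonal.antidiagonal n, repTriangles a p.1 * repTriangles b p.2 := by
  let f : (Σ p : {p // p ∈ Finset.HasAntidiagonal.antidiagonal n},
      {x : Fin a → ℤ // ∑ i, x i * (x i + 1) / 2 = (p.1.1 : ℤ)} ×
      {x : Fin b → ℤ // ∑ i, x i * (x i + 1) / 2 = (p.1.2 : ℤ)}) →
      {x : Fin (a + b) → ℤ // ∑ i, x i * (x i + 1) / 2 = (n : ℤ)} := fun q =>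
    ⟨Fin.append q.2.1.1 q.2.2.1, by
      have h := Finset.HasAntidiagonal.mem_antidiagonal.1 q.1.2
      rw [Fin.sum_univ_add]
      simp only [Fin.append_left, Fin.append_right]
      rw [q.2.1.2, q.2.2.2]
      exact_mod_cast h⟩
  have hf : Function.Bijective f := by
    constructor
    · rintro ⟨⟨⟨i, j⟩, hp⟩, ⟨x, hx⟩, ⟨y, hy⟩⟩ ⟨⟨⟨i', j'⟩, hp'⟩, ⟨x', hx'⟩, ⟨y', hy'⟩⟩ h
      have h1 : Fin.append x y = Fin.append x' y' := congrArg Subtype.val h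
      obtain rfl : x = x' := by
        funext k
        have := congrFun h1 (Fin.castAdd b k)
        rwa [Fin.append_left, Fin.append_left] at this
      obtain rfl : y = y' := by
        funext k
        have := congrFun h1 (Fin.natAdd a k)
        rwa [Fin.append_right, Fin.append_right] at this
      obtain rfl : i = i' := by
        have := hx.symm.trans hx'
        exact_mod_cast this
      obtain rfl : j = j' := by
        have := hy.symm.trans hy'
        exact_mod_cast this
      rfl
    · rintro ⟨x, hx⟩
      have hx2 := hx
      rw [Fin.sum_univ_add] at hx2
      have n1 : 0 ≤ ∑ i : Fin a, x (Fin.castAdd b i) * (x (Fin.castAdd b i) + 1) / 2 :=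
        Finset.sum_nonneg fun i _ => tri_nonneg _
      have n2 : 0 ≤ ∑ i : Fin b, x (Fin.natAdd a i) * (x (Fin.natAdd a i) + 1) / 2 :=
        Finset.sum_nonneg fun i _ => tri_nonneg _
      obtain ⟨i, hi⟩ := Int.eq_ofNat_of_zero_le n1
      obtain ⟨j, hj⟩ := Int.eq_ofNat_of_zero_le n2
      rw [hi, hj] at hx2
      refine ⟨⟨⟨(i, j), Finset.HasAntidiagonal.mem_antidiagonal.2 (by exact_mod_cast hx2)⟩,
        ⟨fun k => x (Fin.castAdd b k), hi⟩, ⟨fun k => x (Fin.natAdd a k), hj⟩⟩, ?_⟩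
      apply Subtype.ext
      exact Fin.append_castAdd_natAdd
  have hfin : ∀ s n, Finite {x : Fin s → ℤ // ∑ i, x i * (x i + 1) / 2 = (n : ℤ)} :=
    fun s n => by
      by_cases hn : 0 ≤ n
      · lift n to ℕ using hn
        exact tri_rep_finite s n
      · have : IsEmpty {x : Fin s → ℤ // ∑ i, x i * (x i + 1) / 2 = (n : ℤ)} :=
          ⟨fun x => hn (x.2 ▸ Finset.sum_nonneg fun i _ => tri_nonneg _)⟩
        infer_instance
  have hc := Nat.card_congr (Equiv.ofBijective f hf)
  rw [Nat.card_sigma] at hc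
  unfold repTriangles
  rw [← hc]
  simp only [Nat.card_prod]
  exact Finset.sum_coe_sort (Finset.HasAntidiagonal.antidiagonal n) (fun p : ℕ × ℕ =>
    Nat.card {x : Fin a → ℤ // ∑ i, x i * (x i + 1) / 2 = (p.1 : ℤ)} *
    Nat.card {x : Fin b → ℤ // ∑ i, x i * (x i + 1) / 2 = (p.2 : ℤ)})

lemma tri_half (x : ℤ) : 2 * (x * (x + 1) / 2) = x * (x + 1) :=
  Int.mul_ediv_cancel' (Int.even_mul_succ_self x).two_dvd

lemma tri_rep_two (n : ℕ) : (repTriangles 2 n : ℤ) = 4 * triE (4 * n + 1) := by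
  rw [← triR_eq _ (by omega), triR, repTriangles, Nat.cast_inj, ← Nat.card_eq_finsetCard]
  refine Nat.card_congr ⟨fun x => ⟨(x.1 0 + x.1 1 + 1, x.1 0 - x.1 1), ?_⟩,
    fun p => ⟨![(p.1.1 + p.1.2 - 1) / 2, (p.1.1 - p.1.2 - 1) / 2], ?_⟩, ?_, ?_⟩
  · have h := x.2
    rw [Fin.sum_univ_two] at h
    rw [mem_triR2]
    have h1 := tri_half (x.1 0)
    have h2 := tri_half (x.1 1)
    push_cast
    linear_combination 4 * h - 2 * h1 - 2 * h2
  · obtain ⟨⟨u, v⟩, hp⟩ := p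
    rw [mem_triR2] at hp
    rw [Fin.sum_univ_two]
    simp only [Matrix.cons_val_zero, Matrix.cons_val_one] at hp ⊢
    push_cast at hp
    have a1 := tri_sq_mod u
    have a2 := tri_sq_mod v
    obtain ⟨x, hx⟩ : ∃ x, u + v - 1 = 2 * x := ⟨(u + v - 1) / 2, by omega⟩
    obtain ⟨y, hy⟩ : ∃ y, u - v - 1 = 2 * y := ⟨(u - v - 1) / 2, by omega⟩
    rw [hx, hy, Int.mul_ediv_cancel_left _ (by norm_num),
      Int.mul_ediv_cancel_left _ (by norm_num)]
    have h1 := tri_half x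
    have h2 := tri_half y
    obtain rfl : u = x + y + 1 := by omega
    obtain rfl : v = x - y := by omega
    linarith
  · intro x
    apply Subtype.ext
    funext i
    fin_cases i
    · simp only [Fin.zero_eta, Fin.isValue, Matrix.cons_val_zero]; omega
    · simp only [Fin.mk_one, Fin.isValue, Matrix.cons_val_one, Matrix.cons_val_fin_one]; omega
  · rintro ⟨⟨u, v⟩, hp⟩
    rw [mem_triR2] at hp
    apply Subtype.ext
    simp only [Matrix.cons_val_zero, Matrix.cons_val_one, Prod.mk.injEq] at hp ⊢
    push_cast at hp
    have a1 := tri_sq_mod u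
    have a2 := tri_sq_mod v
    omega

lemma tri_rep_four (n : ℕ) : (repTriangles 4 n : ℤ) = 16 * triS (2 * n + 1) := by
  rw [show (4 : ℕ) = 2 + 2 by norm_num, tri_rep_add, ← tri_conv4, Finset.mul_sum]
  push_cast
  refine Finset.sum_congr rfl fun p _ => ?_
  rw [tri_rep_two, tri_rep_two]; ring

lemma tri_rep_six (n : ℕ) :
    (repTriangles 6 n : ℤ) = -8 * ∑ c ∈ (4 * n + 3).divisors, triChi c * (c : ℤ) ^ 2 := by
  have h := tri_conv6 n
  have h2 : (repTriangles 6 n : ℤ) = 64 * ∑ p ∈ Finset.HasAntidiagonal.antidiagonal n,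
      triE (4 * p.1 + 1) * triS (2 * p.2 + 1) := by
    rw [show (6 : ℕ) = 2 + 4 by norm_num, tri_rep_add, Finset.mul_sum]
    push_cast
    refine Finset.sum_congr rfl fun p _ => ?_
    rw [tri_rep_two, tri_rep_four]; ring
  rw [h2]; linarith

lemma tri_rep_eight (n : ℕ) :
    (repTriangles 8 n : ℤ) =
      256 * ∑ c ∈ (n + 1).divisors.filter (fun c => ((n + 1) / c) % 2 = 1), (c : ℤ) ^ 3 := by
  rw [show (8 : ℕ) = 4 + 4 by norm_num, tri_rep_add, ← tri_conv8, Finset.mul_sum]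
  push_cast
  refine Finset.sum_congr rfl fun p _ => ?_
  rw [tri_rep_four, tri_rep_four]; ring

lemma tri_w0 (n : ℕ) : ((triE (4 * n + 1) : ℤ) : ℂ) =
    wdiv 0 4 (fun m => if m = 1 then 1 else if m = 3 then -1 else 0) (8 * n + 2) := by
  unfold triE wdiv
  push_cast
  refine Finset.sum_of_injOn (fun d => d) (fun _ _ _ _ h => h) ?_ ?_ ?_
  · intro d hd
    simp only [Finset.mem_coe, Nat.mem_divisors] at hd ⊢
    exact ⟨(show 8 * n + 2 = (4 * n + 1) * 2 by ring) ▸ hd.1.mul_right 2, by omega⟩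
  · intro d hd hd'
    have hd2 : d % 2 = 0 := by
      by_contra h
      apply hd'
      refine ⟨d, ?_, rfl⟩
      simp only [Finset.mem_coe, Nat.mem_divisors] at hd ⊢
      refine ⟨?_, by omega⟩
      have hc : Nat.Coprime d 2 := by
        rw [Nat.coprime_two_right, Nat.odd_iff]; omega
      exact hc.dvd_of_dvd_mul_right ((show 8 * n + 2 = (4 * n + 1) * 2 by ring) ▸ hd.1)
    rw [if_neg (by omega), if_neg (by omega), zero_mul]
  · intro d _
    unfold triChi
    rw [pow_zero, mul_one]
    split_ifs <;> first | omega | simp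

lemma tri_w2 (n : ℕ) :
    ((-∑ c ∈ (4 * n + 3).divisors, triChi c * (c : ℤ) ^ 2 : ℤ) : ℂ) =
    wdiv 2 4 (fun m => if m = 1 then -1 else if m = 3 then 1 else 0) (4 * n + 3) := by
  unfold wdiv
  rw [← Finset.sum_neg_distrib]
  push_cast
  refine Finset.sum_congr rfl fun d _ => ?_
  unfold triChi
  split_ifs <;> first | omega | simp

lemma tri_w3c (n : ℕ) :
    ((∑ c ∈ (n + 1).divisors.filter (fun c => ((n + 1) / c) % 2 = 1), (c : ℤ) ^ 3 : ℤ) : ℂ) =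
    wdivc 3 2 (fun m => if m = 0 then 0 else 1) (n + 1) := by
  unfold wdivc
  rw [Finset.sum_filter]
  push_cast
  refine Finset.sum_congr rfl fun d _ => ?_
  split_ifs <;> first | omega | simp

lemma tri_even_sum (M : ℕ) :
    ∑ c ∈ M.divisors, (if (M / c) % 2 = 1 then 0 else 8 * (c : ℤ) ^ 3) =
    ∑ d ∈ M.divisors, (if d % 2 = 0 then (d : ℤ) ^ 3 else 0) := by
  have h1 : ∑ c ∈ M.divisors, (if (M / c) % 2 = 1 then 0 else 8 * (c : ℤ) ^ 3) =
      ∑ c ∈ M.divisors.filter (fun c => ¬ (M / c) % 2 = 1), 8 * (c : ℤ) ^ 3 := by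
    rw [Finset.sum_filter]
    refine Finset.sum_congr rfl fun c _ => ?_
    split_ifs <;> rfl
  rw [h1, ← Finset.sum_filter]
  refine Finset.sum_nbij' (fun c => 2 * c) (fun d => d / 2) ?_ ?_ ?_ ?_ ?_
  · intro c hc
    simp only [Finset.mem_filter, Nat.mem_divisors] at hc ⊢
    obtain ⟨⟨⟨k, rfl⟩, h0⟩, h2⟩ := hc
    have hc0 : 0 < c := Nat.pos_of_ne_zero fun h => h0 (by simp [h])
    rw [Nat.mul_div_cancel_left _ hc0] at h2
    obtain ⟨j, rfl⟩ : ∃ j, k = 2 * j := ⟨k / 2, by omega⟩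
    exact ⟨⟨⟨j, by ring⟩, h0⟩, by omega⟩
  · intro d hd
    simp only [Finset.mem_filter, Nat.mem_divisors] at hd ⊢
    obtain ⟨⟨⟨k, rfl⟩, h0⟩, h2⟩ := hd
    obtain ⟨c, rfl⟩ : ∃ j, d = 2 * j := ⟨d / 2, by omega⟩
    have hc0 : 0 < c := Nat.pos_of_ne_zero fun h => h0 (by simp [h])
    rw [Nat.mul_div_cancel_left _ (by norm_num), show 2 * c * k = c * (2 * k) by ring,
      Nat.mul_div_cancel_left _ hc0]
    refine ⟨⟨⟨2 * k, rfl⟩, ?_⟩, by omega⟩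
    rwa [show 2 * c * k = c * (2 * k) by ring] at h0
  · intro c _
    simp
  · intro d hd
    have := (Finset.mem_filter.1 hd).2
    omega
  · intro c _
    push_cast
    ring

lemma tri_w3 (n : ℕ) :
    ((8 * ∑ c ∈ (n + 1).divisors.filter (fun c => ((n + 1) / c) % 2 = 1), (c : ℤ) ^ 3 : ℤ) : ℂ) =
    wdiv 3 2 (fun m => if m = 0 then 7 else 8) (n + 1) := by
  have h : wdiv 3 2 (fun m => if m = 0 then 7 else 8) (n + 1) =
      ((∑ d ∈ (n + 1).divisors, (8 * (d : ℤ) ^ 3 - if d % 2 = 0 then (d : ℤ) ^ 3 else 0) : ℤ) : ℂ) := by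
    unfold wdiv
    push_cast
    refine Finset.sum_congr rfl fun d _ => ?_
    split_ifs <;> ring
  rw [h, Int.cast_inj, Finset.sum_sub_distrib, ← tri_even_sum, ← Finset.sum_sub_distrib,
    Finset.sum_filter, Finset.mul_sum]
  refine Finset.sum_congr rfl fun d _ => ?_
  split_ifs <;> ring

theorem sums_of_triangles_formulas (n : ℕ) :
    ((repTriangles 2 n : ℂ) =
        4 * wdiv 0 4 (fun m => if m = 1 then 1 else if m = 3 then -1 else 0) (8 * n + 2)) ∧
    ((repTriangles 4 n : ℂ) = 16 * ∑ d ∈ (2 * n + 1).divisors, (d : ℂ)) ∧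
    ((repTriangles 6 n : ℂ) =
        8 * wdiv 2 4 (fun m => if m = 1 then -1 else if m = 3 then 1 else 0) (4 * n + 3)) ∧
    ((repTriangles 8 n : ℂ) =
        32 * wdiv 3 2 (fun m => if m = 0 then 7 else 8) (n + 1) ∧
      (repTriangles 8 n : ℂ) =
        256 * wdivc 3 2 (fun m => if m = 0 then 0 else 1) (n + 1)) := by
  have c2 : (repTriangles 2 n : ℂ) = ((repTriangles 2 n : ℤ) : ℂ) := by push_cast; rfl
  have c4 : (repTriangles 4 n : ℂ) = ((repTriangles 4 n : ℤ) : ℂ) := by push_cast; rfl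
  have c6 : (repTriangles 6 n : ℂ) = ((repTriangles 6 n : ℤ) : ℂ) := by push_cast; rfl
  have c8 : (repTriangles 8 n : ℂ) = ((repTriangles 8 n : ℤ) : ℂ) := by push_cast; rfl
  refine ⟨?_, ?_, ?_, ?_, ?_⟩
  · rw [c2, tri_rep_two, ← tri_w0]; push_cast; ring
  · rw [c4, tri_rep_four, triS]; push_cast; ring
  · rw [c6, tri_rep_six, ← tri_w2]; push_cast; ring
  · rw [c8, tri_rep_eight, ← tri_w3]; push_cast; ring
  · rw [c8, tri_rep_eight, ← tri_w3c]; push_cast; ring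
end
end
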